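/- arXiv:2411.19087 — 3 statements merged into one kernel-verified Lean document; each statement's English description precedes it below -/
import Mathlib

section
/- Let q be a prime power, m,k positive integers, n ≥ k, and X a k×(n−k) matrix over F_{q^m}. Let U be the F_q-span in F_{q^m}^k of the columns of G = [I_k | X], and let r := rank over F_{q^m} of X^{[1]} − X (each entry of X raised to the power q, minus X). Then the F_{q^m}-dimension of the space of homogeneous polynomials of degree q+1 in F_{q^m}[x_1,…,x_k] vanishing at every point of U equals C(k−r, 2); equivalently, the (q+1)-th term of the F_q-dimension sequence of the code generated by G is h_{q+1} = C(k+q, q+1) − C(k−r, 2). -/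
open MvPolynomial

/-- The `F_{q^m}`-space of homogeneous polynomials of degree `d` in `k` variables
vanishing at every point of `U`. -/
noncomputable def homogVanish (Fqm : Type) [Field Fqm] (k d : ℕ)
    (U : Set (Fin k → Fqm)) : Submodule Fqm (MvPolynomial (Fin k) Fqm) :=
  homogeneousSubmodule (Fin k) Fqm d ⊓
    ⨅ u ∈ U, LinearMap.ker (aeval (R := Fqm) u).toLinearMap

/-- The `F_q`-span of the columns of the matrix `G = [I_k | X]`. -/
noncomputable def colSpanG (Fq Fqm : Type) [Field Fq] [Field Fqm] [Algebra Fq Fqm]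
    (k t : ℕ) (M : Matrix (Fin k) (Fin t) Fqm) : Submodule Fq (Fin k → Fqm) :=
  Submodule.span Fq (Set.range (fun i : Fin k => (Pi.single i 1 : Fin k → Fqm)) ∪
    Set.range (fun j : Fin t => fun i => M i j))

section Alternating

open Matrix

variable {F ι κ : Type*} [Field F] [Fintype ι]

/-- The alternating matrices `B` over `F` whose associated bilinear form vanishes whenever its
first argument is a column of `Y`. -/
def alternatingAnnihilating (Y : Matrix ι κ F) : Submodule F (Matrix ι ι F) where
  carrier := {B | (∀ v, v ⬝ᵥ B *ᵥ v = 0) ∧ Yᵀ * B = 0}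
  zero_mem' := by simp
  add_mem' := by
    rintro A B ⟨hA, hA'⟩ ⟨hB, hB'⟩
    exact ⟨fun v => by simp [Matrix.add_mulVec, hA, hB], by simp [Matrix.mul_add, hA', hB']⟩
  smul_mem' := by
    rintro c A ⟨hA, hA'⟩
    exact ⟨fun v => by simp [Matrix.smul_mulVec, hA], by simp [hA']⟩

lemma mem_alternatingAnnihilating {Y : Matrix ι κ F} {B : Matrix ι ι F} :
    B ∈ alternatingAnnihilating Y ↔ (∀ v, v ⬝ᵥ B *ᵥ v = 0) ∧ Yᵀ * B = 0 := Iff.rfl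

lemma dotProduct_sub_transpose_mulVec_self (L : Matrix ι ι F) (v : ι → F) :
    v ⬝ᵥ (L - Lᵀ) *ᵥ v = 0 := by
  rw [Matrix.sub_mulVec, dotProduct_sub, Matrix.mulVec_transpose, Matrix.dotProduct_mulVec,
    dotProduct_comm, sub_self]

lemma dotProduct_congruence_mulVec_self {σ : Type*} [Fintype σ] (B : Matrix ι ι F)
    (S : Matrix ι σ F) (v : σ → F) : v ⬝ᵥ (Sᵀ * B * S) *ᵥ v = (S *ᵥ v) ⬝ᵥ B *ᵥ (S *ᵥ v) := by
  rw [← Matrix.mulVec_mulVec, ← Matrix.mulVec_mulVec, Matrix.dotProduct_mulVec v Sᵀ,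
    Matrix.vecMul_transpose]

lemma apply_self_eq_zero_of_dotProduct [DecidableEq ι] {B : Matrix ι ι F}
    (hB : ∀ v, v ⬝ᵥ B *ᵥ v = 0) (i : ι) : B i i = 0 := by
  simpa using hB (Pi.single i 1)

lemma apply_eq_neg_of_dotProduct [DecidableEq ι] {B : Matrix ι ι F}
    (hB : ∀ v, v ⬝ᵥ B *ᵥ v = 0) (i j : ι) : B i j = -B j i := by
  have h := hB (Pi.single i 1 + Pi.single j 1)
  simp [Matrix.mulVec_add, apply_self_eq_zero_of_dotProduct hB] at h
  linear_combination h

lemma dotProduct_mulVec_self_eq_zero [LinearOrder ι] {B : Matrix ι ι F}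
    (hd : ∀ i, B i i = 0) (hs : ∀ i j, B i j = -B j i) (v : ι → F) : v ⬝ᵥ B *ᵥ v = 0 := by
  have h : B = Matrix.of (fun i j => if j < i then B i j else 0) -
      (Matrix.of (fun i j => if j < i then B i j else 0))ᵀ := by
    ext i j
    rcases lt_trichotomy i j with h | rfl | h
    · simp [h, h.not_gt, hs i j]
    · simp [hd]
    · simp [h, h.not_gt]
  rw [h]
  exact dotProduct_sub_transpose_mulVec_self _ v

/-- Alternating matrices are determined by their entries below the diagonal. -/
def alternatingEquivLower [LinearOrder ι] :
    alternatingAnnihilating (0 : Matrix ι κ F) ≃ₗ[F] ((Σ i : ι, {j : ι // j < i}) → F) where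
  toFun B p := B.1 p.1 p.2
  map_add' _ _ := rfl
  map_smul' _ _ := rfl
  invFun f := ⟨Matrix.of (fun i j => if h : j < i then f ⟨i, j, h⟩ else 0) -
      (Matrix.of (fun i j => if h : j < i then f ⟨i, j, h⟩ else 0))ᵀ,
    dotProduct_sub_transpose_mulVec_self _, by simp⟩
  left_inv B := by
    ext i j
    rcases lt_trichotomy i j with h | rfl | h
    · simp [h, h.not_gt, apply_eq_neg_of_dotProduct B.2.1 i j]
    · simp [apply_self_eq_zero_of_dotProduct B.2.1 i]
    · simp [h, h.not_gt]
  right_inv f := by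
    ext ⟨i, j, h⟩
    simp [h, h.not_gt]

lemma finrank_alternatingAnnihilating_zero (d : ℕ) :
    Module.finrank F (alternatingAnnihilating (0 : Matrix (Fin d) κ F)) = d.choose 2 := by
  rw [(alternatingEquivLower (F := F) (ι := Fin d) (κ := κ)).finrank_eq, Module.finrank_pi,
    Fintype.card_sigma]
  have h (i : Fin d) : Fintype.card {j : Fin d // j < i} = i := by
    rw [Fintype.card_subtype, ← Fin.card_Iio i]
    congr 1
    ext; simp
  simp_rw [h]
  rw [Fin.sum_univ_eq_sum_range (fun i => i), Finset.sum_range_id, Nat.choose_two_right]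

/-- The alternating forms vanishing on the column space of `Y` are the alternating forms on the
quotient by this column space. -/
def alternatingAnnihilatingEquiv {σ : Type*} [Fintype σ] [DecidableEq ι] [DecidableEq σ]
    [Fintype κ] (Y : Matrix ι κ F) (Q : Matrix σ ι F) (S : Matrix ι σ F) (Z : Matrix κ ι F) (hQY : Q * Y = 0)
    (hQS : Q * S = 1) (hSQ : S * Q = 1 + Y * Z) :
    alternatingAnnihilating Y ≃ₗ[F] alternatingAnnihilating (0 : Matrix σ κ F) where
  toFun B := ⟨Sᵀ * B.1 * S,
    fun v => by rw [dotProduct_congruence_mulVec_self]; exact B.2.1 _, by simp⟩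
  map_add' A B := by ext1; simp [Matrix.mul_add, Matrix.add_mul]
  map_smul' c A := by ext1; simp
  invFun A := ⟨Qᵀ * A.1 * Q,
    fun v => by rw [dotProduct_congruence_mulVec_self]; exact A.2.1 _, by
    rw [Matrix.mul_assoc, ← Matrix.mul_assoc, ← Matrix.transpose_mul, hQY]; simp⟩
  left_inv B := by
    have hB : Yᵀ * B.1 = 0 := B.2.2
    have hB' : B.1 * Y = 0 := by
      have h : (B.1)ᵀ = -B.1 := by
        ext i j; exact apply_eq_neg_of_dotProduct B.2.1 j i
      rw [← Matrix.transpose_inj, Matrix.transpose_mul, h]; simp [hB]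
    ext1
    change Qᵀ * (Sᵀ * B.1 * S) * Q = B.1
    calc Qᵀ * (Sᵀ * B.1 * S) * Q = (S * Q)ᵀ * (B.1 * (S * Q)) := by
          simp only [Matrix.transpose_mul, Matrix.mul_assoc]
      _ = B.1 := by
          rw [hSQ, Matrix.mul_add, ← Matrix.mul_assoc, hB']
          simp [Matrix.transpose_add, Matrix.add_mul, Matrix.mul_assoc, hB]
  right_inv A := by
    ext1
    change Sᵀ * (Qᵀ * A.1 * Q) * S = A.1
    calc Sᵀ * (Qᵀ * A.1 * Q) * S = (Q * S)ᵀ * (A.1 * (Q * S)) := by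
          simp only [Matrix.transpose_mul, Matrix.mul_assoc]
      _ = A.1 := by simp [hQS]

lemma exists_quotient_matrices [DecidableEq ι] [DecidableEq κ] [Fintype κ]
    (Y : Matrix ι κ F) :
    ∃ (Q : Matrix (Fin (Fintype.card ι - Y.rank)) ι F)
      (S : Matrix ι (Fin (Fintype.card ι - Y.rank)) F) (Z : Matrix κ ι F),
      Q * Y = 0 ∧ Q * S = 1 ∧ S * Q = 1 + Y * Z := by
  set W := LinearMap.range Y.mulVecLin with hW
  have hfin : Module.finrank F ((ι → F) ⧸ W) = Fintype.card ι - Y.rank := by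
    rw [Submodule.finrank_quotient, Module.finrank_pi]; rfl
  let e : ((ι → F) ⧸ W) ≃ₗ[F] (Fin (Fintype.card ι - Y.rank) → F) :=
    LinearEquiv.ofFinrankEq _ _ (by simp [hfin])
  let Ql : (ι → F) →ₗ[F] (Fin (Fintype.card ι - Y.rank) → F) := e.toLinearMap ∘ₗ W.mkQ
  have hker : LinearMap.ker Ql = W := by simp [Ql]
  obtain ⟨Sl, hS⟩ := Ql.exists_rightInverse_of_surjective
    (by rw [LinearMap.range_eq_top]; exact e.surjective.comp W.mkQ_surjective)
  have hmem (v : ι → F) : Sl (Ql v) - v ∈ W := by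
    rw [← hker, LinearMap.mem_ker, map_sub, sub_eq_zero]
    exact LinearMap.congr_fun hS (Ql v)
  choose z hz using fun i : ι => hmem (Pi.single i 1)
  refine ⟨Ql.toMatrix', Sl.toMatrix', Matrix.of fun a i => z i a, ?_, ?_, ?_⟩
  · apply Matrix.toLin'.injective
    refine LinearMap.ext fun v => ?_
    have : Y *ᵥ v ∈ LinearMap.ker Ql := hker ▸ ⟨_, rfl⟩
    simpa [Matrix.toLin'_mul] using this
  · rw [← LinearMap.toMatrix'_comp, hS, LinearMap.toMatrix'_id]
  · rw [← LinearMap.toMatrix'_comp, ← sub_eq_iff_eq_add']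
    ext a i
    have := congrFun (hz i) a
    simp [LinearMap.toMatrix'_apply, Matrix.one_apply, Pi.single_apply, Matrix.mul_apply,
      Matrix.mulVec, dotProduct] at this ⊢
    exact this.symm

lemma finrank_alternatingAnnihilating [DecidableEq ι] [DecidableEq κ] [Fintype κ]
    (Y : Matrix ι κ F) :
    Module.finrank F (alternatingAnnihilating Y) = (Fintype.card ι - Y.rank).choose 2 := by
  obtain ⟨Q, S, Z, hQY, hQS, hSQ⟩ := exists_quotient_matrices Y
  rw [(alternatingAnnihilatingEquiv Y Q S Z hQY hQS hSQ).finrank_eq,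
    finrank_alternatingAnnihilating_zero]

end Alternating

section TwistedForm

open Matrix

variable {F ι : Type*} [Field F]

lemma exists_eq_single_add_single {q : ℕ} {d : ι →₀ ℕ} (hd : d.degree = q + 1) {i : ι}
    (hi : q ≤ d i) : ∃ j, d = Finsupp.single i q + Finsupp.single j 1 := by
  obtain ⟨e, rfl⟩ := exists_add_of_le (Finsupp.single_le_iff.2 hi)
  have he : e.degree = 1 := by
    rw [map_add, Finsupp.degree_single] at hd
    omega
  have hne : e ≠ 0 := by rintro rfl; simp at he
  obtain ⟨j, hj⟩ := Finsupp.ne_iff.1 hne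
  obtain ⟨e', rfl⟩ := exists_add_of_le (Finsupp.single_le_iff.2 (Nat.one_le_iff_ne_zero.2 hj))
  rw [map_add, Finsupp.degree_single, add_eq_left, Finsupp.degree_eq_zero_iff] at he
  exact ⟨j, by rw [he, add_zero]⟩

lemma single_add_single_inj {q : ℕ} (hq : 2 ≤ q) {i j a b : ι} :
    Finsupp.single i q + Finsupp.single j 1 = Finsupp.single a q + Finsupp.single b 1 ↔
      i = a ∧ j = b := by
  classical
  refine ⟨fun h => ?_, by rintro ⟨rfl, rfl⟩; rfl⟩
  have hia : i = a := by
    by_contra hne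
    have := DFunLike.congr_fun h i
    simp only [Finsupp.add_apply, Finsupp.single_apply, if_neg (Ne.symm hne), if_true] at this
    split_ifs at this <;> omega
  subst hia
  exact ⟨rfl, Finsupp.single_left_injective one_ne_zero (add_left_cancel h)⟩

variable [Fintype ι]

/-- The polynomial `∑ i, ∑ j, B i j * X i ^ q * X j` attached to a matrix `B`. -/
noncomputable def twistedForm (q : ℕ) : Matrix ι ι F →ₗ[F] MvPolynomial ι F where
  toFun B := ∑ i, ∑ j, monomial (Finsupp.single i q + Finsupp.single j 1) (B i j)
  map_add' A B := by simp [Finset.sum_add_distrib]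
  map_smul' c A := by simp [Finset.smul_sum, smul_monomial]

lemma twistedForm_apply (q : ℕ) (B : Matrix ι ι F) : twistedForm q B =
    ∑ i, ∑ j, monomial (Finsupp.single i q + Finsupp.single j 1) (B i j) := rfl

lemma isHomogeneous_twistedForm (q : ℕ) (B : Matrix ι ι F) :
    (twistedForm q B).IsHomogeneous (q + 1) :=
  .sum _ _ _ fun _ _ => .sum _ _ _ fun _ _ => isHomogeneous_monomial _ (by simp)

lemma eval_twistedForm (q : ℕ) (B : Matrix ι ι F) (u : ι → F) :
    eval u (twistedForm q B) = (fun i => u i ^ q) ⬝ᵥ B *ᵥ u := by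
  classical
  simp only [twistedForm_apply, map_sum, eval_monomial, dotProduct, mulVec, Finset.mul_sum]
  refine Finset.sum_congr rfl fun i _ => Finset.sum_congr rfl fun j _ => ?_
  rw [Finsupp.prod_add_index' (by simp) (by simp [pow_add]), Finsupp.prod_single_index (by simp),
    Finsupp.prod_single_index (by simp)]
  ring

lemma coeff_twistedForm {q : ℕ} (hq : 2 ≤ q) (B : Matrix ι ι F) (i j : ι) :
    coeff (Finsupp.single i q + Finsupp.single j 1) (twistedForm q B) = B i j := by
  classical
  simp only [twistedForm_apply, coeff_sum, coeff_monomial, single_add_single_inj hq]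
  rw [Finset.sum_eq_single i (by intro a _ ha; simp [ha]) (by simp),
    Finset.sum_eq_single j (by intro a _ ha; simp [ha]) (by simp)]
  simp

lemma twistedForm_injective {q : ℕ} (hq : 2 ≤ q) :
    Function.Injective (twistedForm q : Matrix ι ι F →ₗ[F] MvPolynomial ι F) := by
  intro A B h
  ext i j
  rw [← coeff_twistedForm hq A, h, coeff_twistedForm hq B]

lemma eval_single_of_isHomogeneous [DecidableEq ι] {d : ℕ} {f : MvPolynomial ι F}
    (hf : f.IsHomogeneous d) (i : ι) :
    eval (Pi.single i 1) f = coeff (Finsupp.single i d) f := by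
  rw [eval_eq', Finset.sum_eq_single (Finsupp.single i d)]
  · rw [Finset.prod_eq_one, mul_one]
    intro j _
    by_cases h : j = i
    · simp [h]
    · simp [Ne.symm h]
  · intro e he hne
    obtain ⟨j, hji, hj⟩ : ∃ j, j ≠ i ∧ e j ≠ 0 := by
      by_contra! hcon
      have hei : e = Finsupp.single i (e i) := by
        ext j
        by_cases h : j = i
        · simp [h]
        · simp [hcon j h, Ne.symm h]
      have hdeg : e.degree = d := (hf.degree_eq_sum_deg_support he).symm
      rw [hei, Finsupp.degree_single] at hdeg
      exact hne (by rw [hei, hdeg])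
    rw [Finset.prod_eq_zero (Finset.mem_univ j) (by simp [hji, hj]), mul_zero]
  · intro h
    rw [notMem_support_iff.1 h, zero_mul]

/-- A polynomial with exponents below `q` vanishing at all `F_q`-points is zero. -/
lemma eq_zero_of_vanish_of_support_lt {Fq : Type*} [Field Fq] [Fintype Fq] [Algebra Fq F]
    {f : MvPolynomial ι F} (hdeg : ∀ d ∈ f.support, ∀ i, d i < Fintype.card Fq)
    (h : ∀ a : ι → Fq, eval (fun i => algebraMap Fq F (a i)) f = 0) : f = 0 := by
  classical
  refine eq_zero_of_eval_zero_at_prod_finset f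
    (fun _ => Finset.univ.map ⟨algebraMap Fq F, (algebraMap Fq F).injective⟩) ?_ ?_
  · intro i
    rw [Finset.card_map, Finset.card_univ, degreeOf_lt_iff Fintype.card_pos]
    exact fun d hd => hdeg d hd i
  · intro x hx
    simp only [Finset.mem_map, Finset.mem_univ, true_and, Function.Embedding.coeFn_mk] at hx
    choose a ha using hx
    rw [← funext ha]
    exact h a

variable {Fq : Type*} [Field Fq] [Fintype Fq] [Algebra Fq F]

lemma eq_twistedForm_of_vanish {f : MvPolynomial ι F}
    (hf : f.IsHomogeneous (Fintype.card Fq + 1))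
    (h : ∀ a : ι → Fq, eval (fun i => algebraMap Fq F (a i)) f = 0) :
    f = twistedForm (Fintype.card Fq) (Matrix.of fun i j =>
      coeff (Finsupp.single i (Fintype.card Fq) + Finsupp.single j 1) f) := by
  classical
  have hq : 2 ≤ Fintype.card Fq := Fintype.one_lt_card
  set q := Fintype.card Fq
  set B : Matrix ι ι F :=
    Matrix.of fun i j => coeff (Finsupp.single i q + Finsupp.single j 1) f
  have hdiag (i : ι) : B i i = 0 := by
    have hi := h (Pi.single i 1)
    have hs : (fun j => algebraMap Fq F ((Pi.single i 1 : ι → Fq) j)) = Pi.single i 1 := by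
      ext j; simp [Pi.single_apply, apply_ite]
    rwa [hs, eval_single_of_isHomogeneous hf, Finsupp.single_add] at hi
  have hhom := hf.sub (isHomogeneous_twistedForm q B)
  have hlin : (twistedForm 1 B).IsHomogeneous 2 := isHomogeneous_twistedForm 1 B
  have hzero : f - twistedForm q B + twistedForm 1 B = 0 := by
    refine eq_zero_of_vanish_of_support_lt (Fq := Fq) ?_ fun a => ?_
    · intro d hd i
      rcases Finset.mem_union.1 (support_add hd) with hd | hd
      · by_contra! hle
        have hdd := (hhom.degree_eq_sum_deg_support hd).symm
        obtain ⟨j, rfl⟩ := exists_eq_single_add_single hdd hle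
        rw [mem_support_iff, coeff_sub, coeff_twistedForm hq] at hd
        exact hd (sub_self _)
      · by_contra! hle
        rw [mem_support_iff, twistedForm_apply] at hd
        simp only [coeff_sum, coeff_monomial] at hd
        obtain ⟨a, -, ha⟩ := Finset.exists_ne_zero_of_sum_ne_zero hd
        obtain ⟨b, -, hb⟩ := Finset.exists_ne_zero_of_sum_ne_zero ha
        rw [ite_ne_right_iff] at hb
        obtain ⟨rfl, hb⟩ := hb
        have hab : a ≠ b := by rintro rfl; exact hb (hdiag a)
        simp only [Finsupp.add_apply, Finsupp.single_apply] at hle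
        have : a = i → b ≠ i := fun h1 h2 => hab (h1.trans h2.symm)
        split_ifs at hle <;> first | omega | exact this ‹_› ‹_›
    · simp only [map_add, map_sub, h a, eval_twistedForm, ← map_pow]
      simp [q, FiniteField.pow_card]
  have hsub : f - twistedForm q B = 0 := by
    by_contra hne
    have := hhom.inj_right (eq_neg_of_add_eq_zero_left hzero ▸ hlin.neg) hne
    omega
  exact sub_eq_zero.1 hsub

lemma dotProduct_mulVec_self_of_vanish {B : Matrix ι ι F}
    (h : ∀ a : ι → Fq,
      eval (fun i => algebraMap Fq F (a i)) (twistedForm (Fintype.card Fq) B) = 0)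
    (v : ι → F) : v ⬝ᵥ B *ᵥ v = 0 := by
  classical
  have h' (a : ι → Fq) :
      (fun i => algebraMap Fq F (a i)) ⬝ᵥ B *ᵥ (fun i => algebraMap Fq F (a i)) = 0 := by
    simpa only [eval_twistedForm, ← map_pow, FiniteField.pow_card] using h a
  have hs (i : ι) : (fun j => algebraMap Fq F ((Pi.single i 1 : ι → Fq) j)) = Pi.single i 1 := by
    ext j; simp [Pi.single_apply, apply_ite]
  have hd (i : ι) : B i i = 0 := by simpa [hs] using h' (Pi.single i 1)
  have ha (i j : ι) : B i j = -B j i := by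
    have := h' (Pi.single i 1 + Pi.single j 1)
    have e : (fun l => algebraMap Fq F ((Pi.single i 1 + Pi.single j 1 : ι → Fq) l)) =
        Pi.single i 1 + Pi.single j 1 := by
      rw [← hs i, ← hs j]; ext l; simp
    rw [e] at this
    simp [Matrix.mulVec_add, hd] at this
    linear_combination this
  let _ : LinearOrder ι := LinearOrder.lift' _ (Fintype.equivFin ι).injective
  exact dotProduct_mulVec_self_eq_zero hd ha v

end TwistedForm

section ColumnSpan

open Matrix

variable {Fq Fqm : Type} [Field Fq] [Field Fqm] [Algebra Fq Fqm] {k t : ℕ}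

lemma mem_homogVanish {d : ℕ} {U : Set (Fin k → Fqm)} {f : MvPolynomial (Fin k) Fqm} :
    f ∈ homogVanish Fqm k d U ↔ f.IsHomogeneous d ∧ ∀ u ∈ U, eval u f = 0 := by
  simp [homogVanish, Submodule.mem_iInf, aeval_eq_eval]

lemma algebraMap_comp_mem_colSpanG (X : Matrix (Fin k) (Fin t) Fqm) (a : Fin k → Fq) :
    (fun i => algebraMap Fq Fqm (a i)) ∈ colSpanG Fq Fqm k t X := by
  have : (fun i => algebraMap Fq Fqm (a i)) = ∑ i, a i • (Pi.single i 1 : Fin k → Fqm) := by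
    ext j
    simp [Finset.sum_apply, Pi.single_apply, Algebra.smul_def]
  rw [this]
  exact Submodule.sum_mem _ fun i _ =>
    Submodule.smul_mem _ _ (Submodule.subset_span (Or.inl ⟨i, rfl⟩))

lemma exists_pow_card_sub_eq_mulVec [Fintype Fq] (X : Matrix (Fin k) (Fin t) Fqm)
    {u : Fin k → Fqm} (hu : u ∈ colSpanG Fq Fqm k t X) :
    ∃ z, (fun i => u i ^ Fintype.card Fq) - u =
      (X.map (fun x => x ^ Fintype.card Fq) - X) *ᵥ z := by
  set q := Fintype.card Fq
  have hadd (x y : Fqm) : (x + y) ^ q = x ^ q + y ^ q :=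
    map_add (FiniteField.frobeniusAlgHom Fq Fqm) x y
  have hsmul (a : Fq) (x : Fqm) : (a • x) ^ q = a • x ^ q :=
    map_smul (FiniteField.frobeniusAlgHom Fq Fqm) a x
  have hq : q ≠ 0 := Fintype.card_ne_zero
  refine Submodule.span_induction ?_ ?_ ?_ ?_ hu
  · rintro _ (⟨i, rfl⟩ | ⟨j, rfl⟩)
    · refine ⟨0, ?_⟩
      ext l
      by_cases h : l = i <;> simp [h, hq]
    · refine ⟨Pi.single j 1, ?_⟩
      ext l
      simp
  · exact ⟨0, by ext; simp [hq]⟩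
  · rintro x y - - ⟨z, hz⟩ ⟨w, hw⟩
    refine ⟨z + w, ?_⟩
    rw [Matrix.mulVec_add, ← hz, ← hw]
    ext l
    simp only [Pi.add_apply, Pi.sub_apply, hadd]
    ring
  · rintro a x - ⟨z, hz⟩
    refine ⟨a • z, ?_⟩
    rw [Matrix.mulVec_smul, ← hz]
    ext l
    simp only [Pi.smul_apply, Pi.sub_apply, hsmul, smul_sub]

lemma twistedForm_mem_homogVanish_iff [Fintype Fq] (X : Matrix (Fin k) (Fin t) Fqm)
    {B : Matrix (Fin k) (Fin k) Fqm} :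
    twistedForm (Fintype.card Fq) B ∈ homogVanish Fqm k (Fintype.card Fq + 1)
        (colSpanG Fq Fqm k t X : Set (Fin k → Fqm)) ↔
      B ∈ alternatingAnnihilating (X.map (fun x => x ^ Fintype.card Fq) - X) := by
  set q := Fintype.card Fq
  rw [mem_homogVanish, mem_alternatingAnnihilating]
  constructor
  · rintro ⟨-, h⟩
    have halt := dotProduct_mulVec_self_of_vanish fun a => h _ (algebraMap_comp_mem_colSpanG X a)
    refine ⟨halt, ?_⟩
    ext j i
    have hx : (fun l => X l j) ∈ colSpanG Fq Fqm k t X :=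
      Submodule.subset_span (Or.inr ⟨j, rfl⟩)
    have he : (Pi.single i 1 : Fin k → Fqm) ∈ colSpanG Fq Fqm k t X :=
      Submodule.subset_span (Or.inl ⟨i, rfl⟩)
    have h1 := h _ hx
    have h2 := h _ (add_mem hx he)
    have hpow : (fun l => ((fun l => X l j) + Pi.single i 1 : Fin k → Fqm) l ^ q) =
        (fun l => X l j ^ q) + Pi.single i 1 := by
      ext l
      have hadd (x y : Fqm) : (x + y) ^ q = x ^ q + y ^ q :=
        map_add (FiniteField.frobeniusAlgHom Fq Fqm) x y
      by_cases hl : l = i <;> simp [hadd, hl]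
    have h3 := halt ((fun l => X l j) + Pi.single i 1)
    have h4 := halt (fun l => X l j)
    have h5 := halt (Pi.single i 1)
    rw [eval_twistedForm] at h1 h2
    rw [hpow] at h2
    rw [Matrix.mulVec_add, dotProduct_add, add_dotProduct, add_dotProduct] at h2 h3
    have h6 : ((fun l => X l j ^ q) - fun l => X l j) ⬝ᵥ B *ᵥ Pi.single i 1 = 0 := by
      rw [sub_dotProduct]
      linear_combination h2 - h1 - h3 + h4
    rw [Matrix.mulVec_single_one] at h6
    exact h6
  · rintro ⟨halt, hY⟩
    refine ⟨isHomogeneous_twistedForm _ _, fun u hu => ?_⟩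
    obtain ⟨z, hz⟩ := exists_pow_card_sub_eq_mulVec X hu
    rw [eval_twistedForm, sub_eq_iff_eq_add.1 hz, add_dotProduct, halt, add_zero,
      ← Matrix.vecMul_transpose, ← Matrix.dotProduct_mulVec, Matrix.mulVec_mulVec, hY]
    simp

lemma homogVanish_colSpanG_eq_map [Fintype Fq] (X : Matrix (Fin k) (Fin t) Fqm) :
    homogVanish Fqm k (Fintype.card Fq + 1) (colSpanG Fq Fqm k t X : Set (Fin k → Fqm)) =
      (alternatingAnnihilating (X.map (fun x => x ^ Fintype.card Fq) - X)).map
        (twistedForm (Fintype.card Fq)) := by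
  ext f
  rw [Submodule.mem_map]
  constructor
  · intro hf
    obtain ⟨hhom, hvan⟩ := mem_homogVanish.1 hf
    have hfB := eq_twistedForm_of_vanish (Fq := Fq) hhom
      fun a => hvan _ (algebraMap_comp_mem_colSpanG X a)
    exact ⟨_, (twistedForm_mem_homogVanish_iff X).1 (hfB ▸ hf), hfB.symm⟩
  · rintro ⟨B, hB, rfl⟩
    exact (twistedForm_mem_homogVanish_iff X).2 hB

lemma finrank_homogVanish_colSpanG [Fintype Fq] (X : Matrix (Fin k) (Fin t) Fqm) :
    Module.finrank Fqm ↥(homogVanish Fqm k (Fintype.card Fq + 1)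
        (colSpanG Fq Fqm k t X : Set (Fin k → Fqm))) =
      (k - (X.map (fun x => x ^ Fintype.card Fq) - X).rank).choose 2 := by
  rw [homogVanish_colSpanG_eq_map,
    ← (Submodule.equivMapOfInjective _ (twistedForm_injective Fintype.one_lt_card) _).finrank_eq,
    finrank_alternatingAnnihilating, Fintype.card_fin]

end ColumnSpan

theorem statement_1
    (q m k n : ℕ) (hqp : IsPrimePow q) (hm : 0 < m) (hk : 0 < k)
    (Fq Fqm : Type) [Field Fq] [Fintype Fq] [Field Fqm] [Algebra Fq Fqm]
    (hq : Fintype.card Fq = q) (hdeg : Module.finrank Fq Fqm = m)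
    (hn : k ≤ n)
    (X : Matrix (Fin k) (Fin (n - k)) Fqm)
    (r : ℕ) (hr : (X.map (fun x => x ^ q) - X).rank = r) :
    Module.finrank Fqm
        ↥(homogVanish Fqm k (q + 1) (colSpanG Fq Fqm k (n - k) X : Set (Fin k → Fqm)))
      = Nat.choose (k - r) 2 ∧
    Nat.choose (k + q) (q + 1) -
        Module.finrank Fqm
          ↥(homogVanish Fqm k (q + 1) (colSpanG Fq Fqm k (n - k) X : Set (Fin k → Fqm)))
      = Nat.choose (k + q) (q + 1) - Nat.choose (k - r) 2 := by
  subst hq hr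
  have h := finrank_homogVanish_colSpanG (Fq := Fq) X
  exact ⟨h, by rw [h]⟩
end

section
/- Let q be a prime power, m,n,k integers with n ≤ m and 3 ≤ k < n, and let C ⊆ F_{q^m}^n be an MRD code of dimension k with generator matrix G = [I_k | X] in systematic form. Let U be the F_q-span of the columns of G. Then C is a Gabidulin code (i.e., C = G_{1,k}(α_1,…,α_n) for some F_q-linearly independent α_1,…,α_n ∈ F_{q^m}) if and only if the F_{q^m}-dimension of the space of homogeneous polynomials of degree q+1 in F_{q^m}[x_1,…,x_k] vanishing at every point of U equals C(k−1, 2); equivalently, h_{q+1}(C) = C(k+q, q+1) − C(k−1, 2). -/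
open MvPolynomial

/-- The rank weight of a vector `v ∈ F_{q^m}^n`: the `F_q`-dimension of the `F_q`-span
of its entries. -/
noncomputable def rankWeight (Fq Fqm : Type) [Field Fq] [Field Fqm] [Algebra Fq Fqm]
    {n : ℕ} (v : Fin n → Fqm) : ℕ :=
  Module.finrank Fq ↥(Submodule.span Fq (Set.range v))

/-- The minimum rank distance of a (nonzero) linear rank-metric code. -/
noncomputable def minRankDist (Fq Fqm : Type) [Field Fq] [Field Fqm] [Algebra Fq Fqm]
    {n : ℕ} (C : Submodule Fqm (Fin n → Fqm)) : ℕ :=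
  sInf {w | ∃ v ∈ C, v ≠ 0 ∧ rankWeight Fq Fqm v = w}

theorem Matrix.rank_add_finrank_ker_vecMulLinear {F : Type*} [Field F] {a b : ℕ} (Y : Matrix (Fin a) (Fin b) F) :
    Y.rank + Module.finrank F (LinearMap.ker Y.vecMulLinear) = a := by
  have h := LinearMap.finrank_range_add_finrank_ker Y.vecMulLinear
  rw [← Matrix.rank_transpose, Matrix.rank, Matrix.mulVecLin_transpose]
  simpa using h

/-- The space of alternating `d × d` matrices. -/
def altMatrix (F : Type*) [Field F] (d : ℕ) : Submodule F (Matrix (Fin d) (Fin d) F) where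
  carrier := {A | (∀ i, A i i = 0) ∧ ∀ i j, A i j = -A j i}
  add_mem' := by
    rintro A B ⟨hA, hA'⟩ ⟨hB, hB'⟩
    refine ⟨fun i => by simp [hA, hB], fun i j => ?_⟩
    rw [Matrix.add_apply, Matrix.add_apply, hA' i j, hB' i j]; ring
  zero_mem' := by simp
  smul_mem' := by
    rintro c A ⟨hA, hA'⟩
    refine ⟨fun i => by simp [hA], fun i j => ?_⟩
    rw [Matrix.smul_apply, Matrix.smul_apply, hA' i j]; simp

theorem card_fin_pairs_lt (d : ℕ) :
    Fintype.card {p : Fin d × Fin d // p.1 < p.2} = d.choose 2 := by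
  rw [Fintype.card_subtype, Finset.card_filter, Fintype.sum_prod_type_right]
  have h (j : Fin d) : (∑ i : Fin d, if i < j then 1 else 0) = (j : ℕ) := by
    rw [← Finset.card_filter, Finset.filter_gt_eq_Iio, Fin.card_Iio]
  simp only [h]
  rw [Fin.sum_univ_eq_sum_range (fun i => i), Finset.sum_range_id, Nat.choose_two_right]

theorem finrank_altMatrix (F : Type*) [Field F] (d : ℕ) :
    Module.finrank F (altMatrix F d) = d.choose 2 := by
  let e : altMatrix F d ≃ₗ[F] ({p : Fin d × Fin d // p.1 < p.2} → F) :=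
    { toFun := fun A p => A.1 p.1.1 p.1.2
      map_add' := fun _ _ => rfl
      map_smul' := fun _ _ => rfl
      invFun := fun f => ⟨fun i j => if h : i < j then f ⟨(i, j), h⟩ else
          if h : j < i then -f ⟨(j, i), h⟩ else 0, by
        refine ⟨fun i => by simp, fun i j => ?_⟩
        rcases lt_trichotomy i j with h | h | h
        · simp [h, h.not_gt]
        · simp [h]
        · simp [h, h.not_gt]⟩
      left_inv := by
        rintro ⟨A, hA, hA'⟩
        ext i j
        rcases lt_trichotomy i j with h | h | h
        · simp [h]
        · simp [h, hA]
        · simp [h, h.not_gt, hA' i j]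
      right_inv := by
        intro f
        ext ⟨p, hp⟩
        simp [hp] }
  rw [e.finrank_eq, Module.finrank_fintype_fun_eq_card, card_fin_pairs_lt]

/-- The alternating matrices annihilating a given matrix on the right. -/
def altAnnihilator {F : Type*} [Field F] {a b : ℕ} (Y : Matrix (Fin a) (Fin b) F) :
    Submodule F (Matrix (Fin a) (Fin a) F) where
  carrier := {A | A ∈ altMatrix F a ∧ A * Y = 0}
  add_mem' := fun hA hB => ⟨add_mem hA.1 hB.1, by rw [Matrix.add_mul, hA.2, hB.2, add_zero]⟩
  zero_mem' := ⟨zero_mem _, by simp⟩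
  smul_mem' := fun c A hA =>
    ⟨(altMatrix F a).smul_mem c hA.1, by rw [Matrix.smul_mul, hA.2, smul_zero]⟩

theorem transpose_eq_neg_of_mem_altMatrix {F : Type*} [Field F] {d : ℕ}
    {A : Matrix (Fin d) (Fin d) F} (hA : A ∈ altMatrix F d) : A.transpose = -A := by
  ext i j
  exact hA.2 j i

theorem dotProduct_mulVec_self_of_mem_altMatrix {F : Type*} [Field F] {d : ℕ}
    {A : Matrix (Fin d) (Fin d) F} (hA : A ∈ altMatrix F d) (v : Fin d → F) :
    v ⬝ᵥ A.mulVec v = 0 := by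
  simp only [dotProduct, Matrix.mulVec, Finset.mul_sum]
  rw [← Finset.sum_product']
  refine Finset.sum_involution (fun p _ => p.swap) ?_ ?_ (by simp) (by simp)
  · rintro ⟨i, j⟩ -
    simp only [Prod.swap]
    rw [hA.2 i j]; ring
  · rintro ⟨i, j⟩ - h h'
    simp only [Prod.swap, Prod.mk.injEq] at h h'
    obtain ⟨rfl, -⟩ := h'
    simp [hA.1] at h

theorem mem_altMatrix_of_dotProduct {F : Type*} [Field F] {d : ℕ}
    {A : Matrix (Fin d) (Fin d) F} (hA : ∀ v : Fin d → F, v ⬝ᵥ A.mulVec v = 0) :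
    A ∈ altMatrix F d := by
  have h0 (i : Fin d) : A i i = 0 := by
    simpa using hA (Pi.single i 1)
  refine ⟨h0, fun i j => ?_⟩
  have h := hA (Pi.single i 1 + Pi.single j 1)
  simp [Matrix.mulVec_add, h0] at h
  linear_combination h

theorem congr_mem_altMatrix {F : Type*} [Field F] {a b : ℕ}
    {A : Matrix (Fin a) (Fin a) F} (hA : A ∈ altMatrix F a) (P : Matrix (Fin a) (Fin b) F) :
    P.transpose * A * P ∈ altMatrix F b := by
  refine mem_altMatrix_of_dotProduct fun v => ?_
  have := dotProduct_mulVec_self_of_mem_altMatrix hA (P.mulVec v)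
  rw [← this, ← Matrix.mulVec_mulVec, ← Matrix.mulVec_mulVec, Matrix.dotProduct_mulVec,
    Matrix.vecMul_transpose]

theorem finrank_altAnnihilator {F : Type*} [Field F] {a b : ℕ} (Y : Matrix (Fin a) (Fin b) F) :
    Module.finrank F (altAnnihilator Y) = (a - Y.rank).choose 2 := by
  set r := a - Y.rank with hr
  let W := LinearMap.range Y.mulVecLin
  have hW : Module.finrank F ((Fin a → F) ⧸ W) = Module.finrank F (Fin r → F) := by
    have h := W.finrank_quotient_add_finrank
    have h' : Module.finrank F W = Y.rank := rfl
    rw [h'] at h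
    simp at h ⊢
    omega
  let e := LinearEquiv.ofFinrankEq _ _ hW
  let p : (Fin a → F) →ₗ[F] (Fin r → F) := e.toLinearMap ∘ₗ W.mkQ
  have hp_ker : LinearMap.ker p = W := by
    rw [LinearMap.ker_comp, LinearEquiv.ker, Submodule.comap_bot, Submodule.ker_mkQ]
  have hp_range : LinearMap.range p = ⊤ := by
    rw [LinearMap.range_eq_top]
    exact e.surjective.comp W.mkQ_surjective
  obtain ⟨s, hs⟩ := p.exists_rightInverse_of_surjective hp_range
  let P := LinearMap.toMatrix' p
  let S := LinearMap.toMatrix' s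
  have hPS : P * S = 1 := by
    rw [← LinearMap.toMatrix'_comp, hs, LinearMap.toMatrix'_id]
  have hSP : S.transpose * P.transpose = 1 := by
    rw [← Matrix.transpose_mul, hPS, Matrix.transpose_one]
  have hPY : P * Y = 0 := by
    apply Matrix.toLin'.injective
    rw [Matrix.toLin'_mul, Matrix.toLin'_toMatrix', map_zero]
    ext1 x
    ext1
    change p _ = 0
    rw [← LinearMap.mem_ker, hp_ker]
    exact ⟨_, rfl⟩
  have hA (A : Matrix (Fin a) (Fin a) F) (h : A * Y = 0) : A * (S * P) = A := by
    have h1 : A * (1 - S * P) = 0 := by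
      apply Matrix.toLin'.injective
      rw [map_zero]
      refine LinearMap.ext fun x => ?_
      rw [Matrix.toLin'_apply, ← Matrix.mulVec_mulVec]
      have h2 : (1 - S * P).mulVec x ∈ LinearMap.ker p := by
        rw [LinearMap.mem_ker, ← Matrix.toLin'_toMatrix' p, Matrix.toLin'_apply,
          Matrix.mulVec_mulVec]
        change (P * (1 - S * P)).mulVec x = 0
        rw [Matrix.mul_sub, ← Matrix.mul_assoc, hPS]
        simp
      rw [hp_ker] at h2
      obtain ⟨y, hy⟩ := h2
      rw [← hy, Matrix.mulVecLin_apply, Matrix.mulVec_mulVec, h]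
      simp
    rw [Matrix.mul_sub, Matrix.mul_one, sub_eq_zero] at h1
    exact h1.symm
  let E : altMatrix F r ≃ₗ[F] altAnnihilator Y :=
    { toFun := fun B => ⟨P.transpose * B.1 * P, congr_mem_altMatrix B.2 P, by
        rw [Matrix.mul_assoc, hPY, Matrix.mul_zero]⟩
      map_add' := fun B B' => by
        ext1
        simp [Matrix.mul_add, Matrix.add_mul]
      map_smul' := fun c B => by
        ext1
        simp
      invFun := fun A => ⟨S.transpose * A.1 * S, congr_mem_altMatrix A.2.1 S⟩
      left_inv := fun B => by
        ext1
        change S.transpose * (P.transpose * B.1 * P) * S = B.1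
        calc _ = (S.transpose * P.transpose) * B.1 * (P * S) := by simp only [Matrix.mul_assoc]
          _ = _ := by rw [hPS, hSP, Matrix.one_mul, Matrix.mul_one]
      right_inv := fun A => by
        ext1
        change P.transpose * (S.transpose * A.1 * S) * P = A.1
        have h1 := hA A.1 A.2.2
        have h2 := congrArg Matrix.transpose h1
        rw [Matrix.transpose_mul, transpose_eq_neg_of_mem_altMatrix A.2.1, Matrix.mul_neg,
          neg_inj, Matrix.transpose_mul] at h2
        calc _ = (P.transpose * S.transpose * A.1) * (S * P) := by simp only [Matrix.mul_assoc]
          _ = _ := by rw [h2, h1] }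
  rw [← E.finrank_eq, finrank_altMatrix]

theorem choose_two_sub_eq_iff {k r : ℕ} (hk : 3 ≤ k) :
    (k - r).choose 2 = (k - 1).choose 2 ↔ r = 1 := by
  refine ⟨fun h => ?_, fun h => by rw [h]⟩
  obtain ⟨t, rfl⟩ : ∃ t, k = t + 3 := ⟨k - 3, by omega⟩
  have step (s : ℕ) : (s + 1).choose 2 = s + s.choose 2 := by
    rw [Nat.choose_succ_succ' s 1, Nat.choose_one_right]
  rcases Nat.lt_or_ge r 1 with h1 | h1
  · obtain rfl : r = 0 := by omega
    have := step (t + 2)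
    change (t + 3).choose 2 = (t + 2).choose 2 at h
    change (t + 3).choose 2 = _ at this
    omega
  · by_contra h2
    have h3 : (t + 3 - r).choose 2 ≤ (t + 1).choose 2 := Nat.choose_le_choose 2 (by omega)
    have := step (t + 1)
    change _ = (t + 2).choose 2 at h
    change (t + 2).choose 2 = _ at this
    omega

theorem single_add_single_injective {σ : Type*} {q : ℕ} (hq : 2 ≤ q) {i j i' j' : σ}
    (h : Finsupp.single i q + Finsupp.single j 1 = Finsupp.single i' q + Finsupp.single j' 1) :
    i = i' ∧ j = j' := by
  classical
  have hi : i = i' := by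
    by_contra hne
    have := DFunLike.congr_fun h i
    simp only [Finsupp.add_apply, Finsupp.single_apply, if_neg (Ne.symm hne)] at this
    split_ifs at this <;> omega
  subst hi
  rw [add_right_inj] at h
  exact ⟨rfl, (Finsupp.single_left_inj one_ne_zero).1 h⟩

theorem eq_single_add_single_of_degree {σ : Type*} {q : ℕ} {d : σ →₀ ℕ} {i : σ}
    (hd : d.degree = q + 1) (hi : q ≤ d i) :
    ∃ j, d = Finsupp.single i q + Finsupp.single j 1 := by
  classical
  have hle : Finsupp.single i q ≤ d := by
    intro t
    by_cases ht : i = t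
    · subst ht; simpa using hi
    · simp [Finsupp.single_eq_of_ne' ht]
  obtain ⟨e, rfl⟩ := exists_add_of_le hle
  rw [map_add, Finsupp.degree_single] at hd
  obtain ⟨j, rfl⟩ := (show e ∈ Set.range (fun a : σ => Finsupp.single a 1) by
    rw [Finsupp.range_single_one, Set.mem_ofPred_eq]; omega)
  exact ⟨j, rfl⟩

/-- The polynomial `∑ i, ∑ j, A i j * X i ^ q * X j` attached to a matrix `A`. -/
noncomputable def frobForm (F : Type*) [Field F] (k q : ℕ) :
    Matrix (Fin k) (Fin k) F →ₗ[F] MvPolynomial (Fin k) F where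
  toFun A := ∑ i, ∑ j, monomial (Finsupp.single i q + Finsupp.single j 1) (A i j)
  map_add' A B := by simp [Finset.sum_add_distrib]
  map_smul' c A := by simp [Finset.smul_sum, smul_monomial]

theorem frobForm_apply {F : Type*} [Field F] {k q : ℕ} (A : Matrix (Fin k) (Fin k) F) :
    frobForm F k q A =
      ∑ i, ∑ j, monomial (Finsupp.single i q + Finsupp.single j 1) (A i j) := rfl

theorem isHomogeneous_frobForm {F : Type*} [Field F] {k q : ℕ} (A : Matrix (Fin k) (Fin k) F) :
    (frobForm F k q A).IsHomogeneous (q + 1) := by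
  rw [frobForm_apply]
  refine IsHomogeneous.sum _ _ _ fun i _ => IsHomogeneous.sum _ _ _ fun j _ => ?_
  exact isHomogeneous_monomial _ (by simp)

theorem coeff_frobForm {F : Type*} [Field F] {k q : ℕ} (hq : 2 ≤ q)
    (A : Matrix (Fin k) (Fin k) F) (i j : Fin k) :
    coeff (Finsupp.single i q + Finsupp.single j 1) (frobForm F k q A) = A i j := by
  classical
  rw [frobForm_apply]
  simp only [coeff_sum, coeff_monomial]
  rw [Finset.sum_eq_single i, Finset.sum_eq_single j]
  · simp
  · intro t _ ht
    exact if_neg fun h => ht (single_add_single_injective hq h).2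
  · simp
  · intro t _ ht
    exact Finset.sum_eq_zero fun s _ => if_neg fun h => ht (single_add_single_injective hq h).1
  · simp

theorem frobForm_injective {F : Type*} [Field F] {k q : ℕ} (hq : 2 ≤ q) :
    Function.Injective (frobForm F k q) := by
  intro A B h
  ext i j
  rw [← coeff_frobForm hq A, h, coeff_frobForm hq]

theorem eval_frobForm {F : Type*} [Field F] {k q : ℕ} (A : Matrix (Fin k) (Fin k) F)
    (u : Fin k → F) :
    eval u (frobForm F k q A) = (fun i => u i ^ q) ⬝ᵥ A.mulVec u := by
  rw [frobForm_apply]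
  simp only [map_sum, eval_monomial, dotProduct, Matrix.mulVec, Finset.mul_sum]
  refine Finset.sum_congr rfl fun i _ => Finset.sum_congr rfl fun j _ => ?_
  rw [Finsupp.prod_add_index' (by simp) (by simp [pow_add])]
  simp
  ring

theorem exists_eq_frobForm {K F : Type*} [Field K] [Fintype K] [Field F] [Algebra K F] {k : ℕ}
    {p : MvPolynomial (Fin k) F} (hp : p.IsHomogeneous (Fintype.card K + 1))
    (h : ∀ a : Fin k → K, eval (fun i => algebraMap K F (a i)) p = 0) :
    ∃ A ∈ altMatrix F k, p = frobForm F k (Fintype.card K) A := by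
  classical
  set q := Fintype.card K with hq_def
  have hq : 2 ≤ q := Fintype.one_lt_card
  let A : Matrix (Fin k) (Fin k) F :=
    Matrix.of fun i j => coeff (Finsupp.single i q + Finsupp.single j 1) p
  let N := p - frobForm F k q A
  have hN : N.IsHomogeneous (q + 1) := hp.sub (isHomogeneous_frobForm A)
  let Q : MvPolynomial (Fin k) F := ∑ i, ∑ j,
    monomial (Finsupp.single i 1 + Finsupp.single j 1) (A i j)
  have hQ : Q.IsHomogeneous 2 :=
    IsHomogeneous.sum _ _ _ fun i _ => IsHomogeneous.sum _ _ _ fun j _ =>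
      isHomogeneous_monomial _ (by simp)
  have hNdeg (d : Fin k →₀ ℕ) (hd : coeff d N ≠ 0) : d.degree = q + 1 :=
    by_contra fun h => hd (hN.coeff_eq_zero h)
  have hNcoeff (d : Fin k →₀ ℕ) (hd : coeff d N ≠ 0) (i : Fin k) : d i < q := by
    by_contra hlt
    obtain ⟨j, rfl⟩ := eq_single_add_single_of_degree (hNdeg d hd) (not_lt.1 hlt)
    apply hd
    simp only [N, coeff_sub, coeff_frobForm hq]
    simp [A]
  have hNeval (i : Fin k) : eval (Pi.single i 1) N = 0 := by
    rw [eval_eq']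
    refine Finset.sum_eq_zero fun d hd => ?_
    rw [mem_support_iff] at hd
    obtain ⟨j, hji, hj⟩ : ∃ j, j ≠ i ∧ d j ≠ 0 := by
      by_contra! hcon
      have h1 := hNdeg d hd
      rw [Finsupp.degree_eq_sum, Finset.sum_eq_single i (fun j _ => hcon j) (by simp)] at h1
      have := hNcoeff d hd i
      omega
    rw [Finset.prod_eq_zero (Finset.mem_univ j), mul_zero]
    rw [Pi.single_eq_of_ne hji, zero_pow hj]
  have hpN : p = N + frobForm F k q A := by simp [N]
  have hsingle (i : Fin k) : (Pi.single i 1 : Fin k → F) =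
      fun t => algebraMap K F ((Pi.single i 1 : Fin k → K) t) := by
    ext t
    by_cases ht : t = i
    · subst ht; simp
    · simp [ht]
  have hrat (a : Fin k → K) :
      (fun i => algebraMap K F (a i) ^ q) = fun i => algebraMap K F (a i) := by
    simp [← map_pow, hq_def, FiniteField.pow_card]
  have hA0 (i : Fin k) : A i i = 0 := by
    have h1 := h (Pi.single i 1)
    rw [← hsingle, hpN, map_add, hNeval, zero_add, eval_frobForm] at h1
    rw [hsingle, hrat, ← hsingle] at h1
    simpa using h1
  have hevalQ (a : Fin k → K) : eval (fun i => algebraMap K F (a i)) Q =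
      eval (fun i => algebraMap K F (a i)) (frobForm F k q A) := by
    simp only [Q, frobForm_apply, map_sum, eval_monomial]
    refine Finset.sum_congr rfl fun i _ => Finset.sum_congr rfl fun j _ => ?_
    rw [Finsupp.prod_add_index' (by simp) (by simp [pow_add]),
      Finsupp.prod_add_index' (by simp) (by simp [pow_add])]
    simp [← map_pow, hq_def, FiniteField.pow_card]
  have hQcoeff (d : Fin k →₀ ℕ) (hd : coeff d Q ≠ 0) (t : Fin k) : d t < q := by
    by_contra hlt
    apply hd
    simp only [Q, coeff_sum, coeff_monomial]
    refine Finset.sum_eq_zero fun i _ => Finset.sum_eq_zero fun j _ => ?_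
    split_ifs with hij
    · subst hij
      have : i = j := by
        by_contra hne
        simp only [Finsupp.add_apply, Finsupp.single_apply] at hlt
        split_ifs at hlt with h1 h2
        · exact hne (h1.trans h2.symm)
        all_goals omega
      rw [this, hA0]
    · rfl
  have hNQ : N + Q = 0 := by
    refine eq_zero_of_eval_zero_at_prod_finset _
      (fun _ => Finset.univ.map ⟨algebraMap K F, (algebraMap K F).injective⟩) ?_ ?_
    · intro i
      rw [Finset.card_map, Finset.card_univ, ← hq_def, degreeOf_lt_iff (by omega)]
      intro d hd
      rw [mem_support_iff, coeff_add] at hd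
      by_cases hdN : coeff d N = 0
      · exact hQcoeff d (by simpa [hdN] using hd) i
      · exact hNcoeff d hdN i
    · intro x hx
      simp only [Finset.mem_map, Finset.mem_univ, true_and, Function.Embedding.coeFn_mk] at hx
      choose a ha using hx
      obtain rfl : (fun i => algebraMap K F (a i)) = x := funext ha
      rw [map_add, hevalQ, ← map_add, ← hpN, h]
  have hN0 : N = 0 := by
    ext d
    rw [coeff_zero]
    by_contra hd
    have h1 := hNdeg d hd
    have h2 := congrArg (coeff d) hNQ
    rw [coeff_add, hQ.coeff_eq_zero (by omega), add_zero, coeff_zero] at h2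
    exact hd h2
  have hpA : p = frobForm F k q A := by rw [hpN, hN0, zero_add]
  refine ⟨A, ⟨hA0, fun i j => ?_⟩, hpA⟩
  have h1 := h (Pi.single i 1 + Pi.single j 1)
  have h2 : (fun t => algebraMap K F ((Pi.single i 1 + Pi.single j 1 : Fin k → K) t)) =
      Pi.single i 1 + Pi.single j 1 := by
    rw [hsingle, hsingle]
    ext t
    simp
  rw [hpA, eval_frobForm, hrat, h2] at h1
  simp [Matrix.mulVec_add, hA0] at h1
  linear_combination h1

theorem mulVec_sub_frobenius_eq_zero {K F : Type*} [Field K] [Fintype K] [Field F] [Algebra K F]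
    {k n : ℕ} {A : Matrix (Fin k) (Fin k) F} {G : Matrix (Fin k) (Fin n) F}
    (hA : A * (G - G.map (FiniteField.frobeniusAlgHom K F)) = 0) {u : Fin k → F}
    (hu : u ∈ Submodule.span K (Set.range fun j : Fin n => fun i => G i j)) :
    A.mulVec u = A.mulVec (fun i => u i ^ Fintype.card K) := by
  let φ := FiniteField.frobeniusAlgHom K F
  change A.mulVec u = A.mulVec (fun i => φ (u i))
  induction hu using Submodule.span_induction with
  | mem x hx =>
    obtain ⟨j, rfl⟩ := hx
    rw [Matrix.mul_sub, sub_eq_zero] at hA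
    ext i
    exact congrFun (congrFun hA i) j
  | zero =>
    simp only [Pi.zero_apply, map_zero]
    rfl
  | add x y _ _ hx hy =>
    rw [Matrix.mulVec_add, hx, hy, ← Matrix.mulVec_add]
    congr 1
    ext i
    simp
  | smul a x _ hx =>
    rw [Matrix.mulVec_smul, hx, ← Matrix.mulVec_smul]
    congr 1
    ext i
    simp only [Pi.smul_apply, map_smul]

theorem homogVanish_eq_map {K F : Type} [Field K] [Fintype K] [Field F] [Algebra K F]
    {k n : ℕ} (G : Matrix (Fin k) (Fin n) F)
    (hG : ∀ i : Fin k, ∃ j, (fun t => G t j) = Pi.single i 1) :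
    homogVanish F k (Fintype.card K + 1)
        (Submodule.span K (Set.range fun j : Fin n => fun i => G i j) : Set (Fin k → F)) =
      (altAnnihilator (G - G.map (FiniteField.frobeniusAlgHom K F))).map
        (frobForm F k (Fintype.card K)) := by
  set q := Fintype.card K with hq_def
  set U := Submodule.span K (Set.range fun j : Fin n => fun i => G i j) with hU
  let φ := FiniteField.frobeniusAlgHom K F
  have hmem (p : MvPolynomial (Fin k) F) : p ∈ homogVanish F k (q + 1) (U : Set (Fin k → F)) ↔
      p.IsHomogeneous (q + 1) ∧ ∀ u ∈ U, eval u p = 0 := by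
    simp [homogVanish, mem_homogeneousSubmodule, aeval_eq_eval]
  have hcol (j : Fin n) : (fun t => G t j) ∈ U := Submodule.subset_span ⟨j, rfl⟩
  have hstd (i : Fin k) : Pi.single i 1 ∈ U := by
    obtain ⟨j, hj⟩ := hG i
    exact hj ▸ hcol j
  ext p
  rw [hmem, Submodule.mem_map]
  constructor
  · rintro ⟨hp, hv⟩
    obtain ⟨A, hA, rfl⟩ := exists_eq_frobForm (K := K) hp (fun a => hv _ (by
      have : (fun i => algebraMap K F (a i)) = ∑ i, a i • (Pi.single i 1 : Fin k → F) := by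
        ext t
        simp [Finset.sum_apply, Pi.single_apply, Algebra.smul_def]
      rw [this]
      exact Submodule.sum_mem _ fun i _ => U.smul_mem _ (hstd i)))
    refine ⟨A, ⟨hA, ?_⟩, rfl⟩
    have hv' (u : Fin k → F) (hu : u ∈ U) : (fun i => φ (u i)) ⬝ᵥ A.mulVec u = 0 := by
      rw [← hv u hu, eval_frobForm]
      rfl
    ext i j
    rw [Matrix.mul_sub, Matrix.sub_apply, Matrix.zero_apply, sub_eq_zero]
    let u : Fin k → F := fun t => G t j
    change A.mulVec u i = A.mulVec (fun t => φ (u t)) i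
    have h1 := hv' _ (hcol j)
    have h2 := hv' _ (add_mem (hstd i) (hcol j))
    have h3 : (fun t => φ ((Pi.single i 1 + u : Fin k → F) t)) =
        Pi.single i 1 + fun t => φ (u t) := by
      ext t
      by_cases ht : t = i
      · subst ht; simp
      · simp [ht]
    change (fun t => φ (u t)) ⬝ᵥ A.mulVec u = 0 at h1
    change (fun t => φ ((Pi.single i 1 + u : Fin k → F) t)) ⬝ᵥ
      A.mulVec (Pi.single i 1 + u) = 0 at h2
    rw [h3, Matrix.mulVec_add, add_dotProduct, dotProduct_add, dotProduct_add, h1,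
      dotProduct_mulVec_self_of_mem_altMatrix hA, Matrix.dotProduct_mulVec (fun t => φ (u t)),
      ← Matrix.mulVec_transpose, transpose_eq_neg_of_mem_altMatrix hA] at h2
    simp [Matrix.neg_mulVec] at h2
    linear_combination h2
  · rintro ⟨A, ⟨hA, hAY⟩, rfl⟩
    refine ⟨isHomogeneous_frobForm A, fun u hu => ?_⟩
    rw [eval_frobForm, mulVec_sub_frobenius_eq_zero hAY hu]
    exact dotProduct_mulVec_self_of_mem_altMatrix hA _

theorem finrank_homogVanish {K F : Type} [Field K] [Fintype K] [Field F] [Algebra K F]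
    {k n : ℕ} (G : Matrix (Fin k) (Fin n) F)
    (hG : ∀ i : Fin k, ∃ j, (fun t => G t j) = Pi.single i 1) :
    Module.finrank F (homogVanish F k (Fintype.card K + 1)
        (Submodule.span K (Set.range fun j : Fin n => fun i => G i j) : Set (Fin k → F))) =
      (k - (G - G.map (FiniteField.frobeniusAlgHom K F)).rank).choose 2 := by
  rw [homogVanish_eq_map G hG, ← finrank_altAnnihilator]
  exact (Submodule.equivMapOfInjective _ (frobForm_injective Fintype.one_lt_card)
    _).finrank_eq.symm

theorem mem_range_algebraMap_of_pow_card_eq {K F : Type*} [Field K] [Fintype K] [Field F]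
    [Algebra K F] {x : F} (hx : x ^ Fintype.card K = x) : x ∈ Set.range (algebraMap K F) := by
  classical
  have hne := FiniteField.X_pow_card_sub_X_ne_zero F (Fintype.one_lt_card (α := K))
  by_contra hnot
  have hsub : insert x (Finset.univ.image (algebraMap K F)) ⊆
      (Polynomial.X ^ Fintype.card K - Polynomial.X : Polynomial F).roots.toFinset := by
    intro y hy
    rw [Multiset.mem_toFinset, Polynomial.mem_roots hne]
    rw [Finset.mem_insert, Finset.mem_image] at hy
    rcases hy with rfl | ⟨a, -, rfl⟩
    · simp [hx]
    · simp [← map_pow, FiniteField.pow_card]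
  have h1 := (Finset.card_le_card hsub).trans (Multiset.toFinset_card_le _)
  have h2 := Polynomial.card_roots' (Polynomial.X ^ Fintype.card K - Polynomial.X : Polynomial F)
  rw [FiniteField.X_pow_card_sub_X_natDegree_eq F (Fintype.one_lt_card (α := K))] at h2
  rw [Finset.card_insert_of_notMem (by simpa using hnot),
    Finset.card_image_of_injective _ (algebraMap K F).injective, Finset.card_univ] at h1
  omega

theorem exists_rational_of_frobenius_stable {K F : Type*} [Field K] [Fintype K] [Field F]
    [Algebra K F] {n : ℕ} {D : Submodule F (Fin n → F)}
    (hD : ∀ v ∈ D, (fun j => v j ^ Fintype.card K) ∈ D) {v : Fin n → F} (hv : v ∈ D)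
    (hv0 : v ≠ 0) : ∃ w ∈ D, w ≠ 0 ∧ ∀ j, w j ∈ Set.range (algebraMap K F) := by
  classical
  induction hN : (Finset.univ.filter fun j => v j ≠ 0).card using Nat.strong_induction_on
    generalizing v with
  | _ N ih =>
    obtain ⟨j, hj⟩ := Function.ne_iff.1 hv0
    let w : Fin n → F := (v j)⁻¹ • v
    have hw : w ∈ D := D.smul_mem _ hv
    have hwj : w j = 1 := inv_mul_cancel₀ hj
    let u : Fin n → F := (fun j => w j ^ Fintype.card K) - w
    by_cases hu : u = 0
    · refine ⟨w, hw, fun h => by simp [h] at hwj, fun t => ?_⟩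
      exact mem_range_algebraMap_of_pow_card_eq (sub_eq_zero.1 (congrFun hu t))
    · refine ih _ ?_ (D.sub_mem (hD w hw) hw) hu rfl
      rw [← hN]
      refine Finset.card_lt_card (Finset.ssubset_iff_of_subset ?_ |>.2 ⟨j, ?_, ?_⟩)
      · intro t
        simp only [Finset.mem_filter, Finset.mem_univ, true_and]
        contrapose!
        intro ht
        simp [w, ht]
      · simpa using hj
      · simp [hwj]

theorem linearIndependent_frobenius_iterates {K F : Type*} [Field K] [Fintype K] [Field F]
    [Algebra K F] {n : ℕ} {C : Submodule F (Fin n → F)}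
    (hC : ∀ v ∈ C, v ≠ 0 → ¬ ∀ j, v j ∈ Set.range (algebraMap K F))
    {α : Fin n → F} (hα : α ≠ 0) (k : ℕ)
    (hk : ∀ i < k, (fun j => α j ^ Fintype.card K ^ i) ∈ C) :
    LinearIndependent F fun (i : Fin k) (j : Fin n) => α j ^ Fintype.card K ^ (i : ℕ) := by
  induction k with
  | zero => exact linearIndependent_empty_type
  | succ k ih =>
    rw [linearIndependent_finSucc']
    refine ⟨ih fun i hi => hk i (by omega), fun hlast => ?_⟩
    set D := Submodule.span F (Set.range (Fin.init
      fun (i : Fin (k + 1)) (j : Fin n) => α j ^ Fintype.card K ^ (i : ℕ))) with hD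
    have hDC : D ≤ C := by
      rw [hD, Submodule.span_le]
      rintro _ ⟨i, rfl⟩
      exact hk i (by omega)
    have hmem (i : ℕ) (hi : i ≤ k) : (fun j => α j ^ Fintype.card K ^ i) ∈ D := by
      rcases hi.lt_or_eq with hi | rfl
      · exact Submodule.subset_span ⟨⟨i, hi⟩, rfl⟩
      · exact hlast
    let φ := FiniteField.frobeniusAlgHom K F
    have hstable : ∀ v ∈ D, (fun j => φ (v j)) ∈ D := by
      intro v hv
      induction hv using Submodule.span_induction with
      | mem x hx =>
        obtain ⟨i, rfl⟩ := hx
        convert! hmem (i + 1) (by omega) using 2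
        rw [pow_succ, pow_mul]
        rfl
      | zero =>
        simp only [Pi.zero_apply, map_zero]
        exact D.zero_mem
      | add x y _ _ hx hy =>
        convert! D.add_mem hx hy using 1
        ext j
        simp
      | smul a x _ hx =>
        convert! D.smul_mem (φ a) hx using 1
        ext j
        simp
    have hα' : α ∈ D := by simpa using hmem 0 (Nat.zero_le _)
    obtain ⟨w, hw, hw0, hw'⟩ := exists_rational_of_frobenius_stable (K := K) hstable hα' hα
    exact hC w (hDC hw) hw0 hw'

theorem rankWeight_le_card {K F : Type} [Field K] [Field F] [Algebra K F] [FiniteDimensional K F]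
    {n : ℕ} {v : Fin n → F} (s : Finset F) (h : ∀ j, v j ∈ Submodule.span K (s : Set F)) :
    rankWeight K F v ≤ s.card := by
  refine (Submodule.finrank_mono (Submodule.span_le.2 ?_)).trans (finrank_span_finset_le_card s)
  rintro _ ⟨j, rfl⟩
  exact h j

theorem not_rational_of_two_le_rankWeight {K F : Type} [Field K] [Field F] [Algebra K F]
    [FiniteDimensional K F] {n : ℕ} {v : Fin n → F} (hv : 2 ≤ rankWeight K F v) :
    ¬ ∀ j, v j ∈ Set.range (algebraMap K F) := by
  intro h
  have := rankWeight_le_card (K := K) (v := v) {1} fun j => by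
    obtain ⟨a, ha⟩ := h j
    rw [Finset.coe_singleton, Submodule.mem_span_singleton]
    exact ⟨a, by rw [← ha, Algebra.algebraMap_eq_smul_one]⟩
  rw [Finset.card_singleton] at this
  omega

theorem rankWeight_lt_of_relation {K F : Type} [Field K] [Field F] [Algebra K F]
    [FiniteDimensional K F] {n : ℕ} {v : Fin n → F} (T : Finset (Fin n))
    (hT : ∀ j ∉ T, v j = 0) {a : Fin n → K} {t : Fin n} (ht : t ∈ T) (hat : a t ≠ 0)
    (ha : ∑ j, a j • v j = 0) : rankWeight K F v < T.card := by
  classical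
  have hmem (j : Fin n) (hj : j ≠ t) :
      v j ∈ Submodule.span K (((T.erase t).image v : Finset F) : Set F) := by
    by_cases hjT : j ∈ T
    · exact Submodule.subset_span (by
        rw [Finset.mem_coe]
        exact Finset.mem_image_of_mem _ (Finset.mem_erase.2 ⟨hj, hjT⟩))
    · rw [hT j hjT]
      exact Submodule.zero_mem _
  refine (rankWeight_le_card (K := K) ((T.erase t).image v) fun j => ?_).trans_lt
    (Finset.card_image_le.trans_lt (Finset.card_erase_lt_of_mem ht))
  by_cases hj : j = t
  · subst hj
    rw [← Finset.add_sum_erase _ _ (Finset.mem_univ j), add_eq_zero_iff_eq_neg] at ha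
    rw [← inv_smul_smul₀ hat (v j), ha]
    refine Submodule.smul_mem _ _ (Submodule.neg_mem _ (Submodule.sum_mem _ fun i hi => ?_))
    exact Submodule.smul_mem _ _ (hmem i (Finset.ne_of_mem_erase hi))
  · exact hmem j hj

theorem eq_zero_of_forall_relation {K F : Type} [Field K] [Field F] [Algebra K F]
    [FiniteDimensional K F] {n k : ℕ} (hk : 0 < k) (hkn : k ≤ n) {G : Matrix (Fin k) (Fin n) F}
    (hG : ∀ i : Fin k, ∀ j : Fin n, (j : ℕ) < k → G i j = if (j : ℕ) = (i : ℕ) then 1 else 0)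
    (hw : ∀ i, n - k + 1 ≤ rankWeight K F (G i)) {a : Fin n → K}
    (ha : ∀ i, ∑ j, a j • G i j = 0) : a = 0 := by
  classical
  by_contra hne
  obtain ⟨t, ht⟩ := Function.ne_iff.1 hne
  obtain ⟨i, hi⟩ : ∃ i : Fin k, (t : ℕ) < k → (t : ℕ) = i := by
    by_cases htk : (t : ℕ) < k
    · exact ⟨⟨t, htk⟩, fun _ => rfl⟩
    · exact ⟨⟨0, hk⟩, fun h => absurd h htk⟩
  let R : Finset (Fin n) := Finset.univ.filter fun j => k ≤ (j : ℕ)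
  have hR : R.card = n - k := by
    have h1 : R = Finset.univ \ Finset.univ.map (Fin.castLEEmb hkn) := by
      ext j
      simp only [R, Finset.mem_filter, Finset.mem_univ, true_and, Finset.mem_sdiff,
        Finset.mem_map, not_exists]
      constructor
      · rintro h x rfl
        simp at h
        omega
      · intro h
        by_contra hlt
        exact h ⟨j, by omega⟩ rfl
    rw [h1, Finset.card_sdiff_of_subset (Finset.subset_univ _)]
    simp
  have hlt := rankWeight_lt_of_relation (K := K) (v := G i) (insert (Fin.castLE hkn i) R)
    (t := t) (a := a) ?_ ?_ ht (ha i)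
  · have := hw i
    have := Finset.card_insert_le (Fin.castLE hkn i) R
    omega
  · intro j hj
    simp only [Finset.mem_insert, not_or, R, Finset.mem_filter, Finset.mem_univ, true_and,
      not_le, Fin.ext_iff, Fin.val_castLE] at hj
    rw [hG i j hj.2, if_neg hj.1]
  · by_cases htk : (t : ℕ) < k
    · exact Finset.mem_insert.2 (Or.inl (Fin.ext (hi htk)))
    · exact Finset.mem_insert_of_mem (by simpa [R] using htk)

theorem vecMul_castLE {F : Type*} [Field F] {n k : ℕ} (hkn : k ≤ n)
    {G : Matrix (Fin k) (Fin n) F}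
    (hG : ∀ i : Fin k, ∀ j : Fin n, (j : ℕ) < k → G i j = if (j : ℕ) = (i : ℕ) then 1 else 0)
    (a : Fin k → F) (i : Fin k) : Matrix.vecMul a G (Fin.castLE hkn i) = a i := by
  have h (l : Fin k) : G l (Fin.castLE hkn i) = if l = i then 1 else 0 := by
    rw [hG l _ (by simp)]
    simp [Fin.ext_iff, eq_comm]
  simp [Matrix.vecMul, dotProduct, h]

theorem vecMul_castLE_of_mem {F : Type*} [Field F] {n k : ℕ} (hkn : k ≤ n)
    {G : Matrix (Fin k) (Fin n) F}
    (hG : ∀ i : Fin k, ∀ j : Fin n, (j : ℕ) < k → G i j = if (j : ℕ) = (i : ℕ) then 1 else 0)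
    {v : Fin n → F} (hv : v ∈ Submodule.span F (Set.range G)) :
    Matrix.vecMul (fun i => v (Fin.castLE hkn i)) G = v := by
  change v ∈ Submodule.span F (Set.range G.row) at hv
  rw [← range_vecMulLinear] at hv
  obtain ⟨a, rfl⟩ := hv
  congr 1
  ext i
  exact vecMul_castLE hkn hG a i

theorem rank_sub_frobenius_le_one {K F : Type*} [Field K] [Fintype K] [Field F] [Algebra K F]
    {n k : ℕ} (hkn : k ≤ n) {G : Matrix (Fin k) (Fin n) F}
    (hG : ∀ i : Fin k, ∀ j : Fin n, (j : ℕ) < k → G i j = if (j : ℕ) = (i : ℕ) then 1 else 0)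
    (hrank : Module.finrank F (Submodule.span F (Set.range G)) = k) {α : Fin n → F}
    (hα : Submodule.span F (Set.range G) = Submodule.span F
      (Set.range fun (i : Fin k) (j : Fin n) => α j ^ Fintype.card K ^ (i : ℕ))) :
    (G - G.map (FiniteField.frobeniusAlgHom K F)).rank ≤ 1 := by
  let φ := FiniteField.frobeniusAlgHom K F
  set Y := G - G.map φ with hY
  let w : Fin k → Fin n → F := fun i j => α j ^ Fintype.card K ^ (i : ℕ)
  let β : Fin k → Fin k → F := fun i l => w i (Fin.castLE hkn l)
  have hβ (i : Fin k) : Matrix.vecMul (β i) G = w i :=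
    vecMul_castLE_of_mem hkn hG (by rw [hα]; exact Submodule.subset_span ⟨i, rfl⟩)
  have hw : LinearIndependent F w := by
    rw [linearIndependent_iff_card_eq_finrank_span, Set.finrank, ← hα, hrank, Fintype.card_fin]
  have hβ' : LinearIndependent F β := by
    refine LinearIndependent.of_comp G.vecMulLinear ?_
    convert! hw using 1
    ext1 i
    exact hβ i
  have hker (i : Fin k) (hi : (i : ℕ) ≠ 0) : β i ∈ LinearMap.ker Y.vecMulLinear := by
    obtain ⟨i, hik⟩ := i
    obtain ⟨s, rfl⟩ : ∃ s, i = s + 1 := ⟨i - 1, by simp at hi; omega⟩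
    have hφw (j : Fin n) : φ (w ⟨s, by omega⟩ j) = w ⟨s + 1, hik⟩ j := by
      simp only [w]
      rw [pow_succ, pow_mul]
      rfl
    rw [LinearMap.mem_ker, Matrix.vecMulLinear_apply, hY, Matrix.vecMul_sub, hβ, sub_eq_zero]
    ext j
    rw [← hφw, ← hβ]
    have := RingHom.map_vecMul (φ : F →+* F) G (β ⟨s, by omega⟩) j
    refine this.trans ?_
    congr 1
    ext l
    exact hφw _
  have hk1 : k - 1 ≤ Module.finrank F (LinearMap.ker Y.vecMulLinear) := by
    let f : Fin (k - 1) → LinearMap.ker Y.vecMulLinear :=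
      fun i => ⟨β ⟨i + 1, by omega⟩, hker _ (by simp)⟩
    have hf : LinearIndependent F f := by
      refine LinearIndependent.of_comp (Submodule.subtype _) ?_
      exact hβ'.comp (fun i : Fin (k - 1) => (⟨i + 1, by omega⟩ : Fin k)) fun i j h => by
        simpa [Fin.ext_iff] using h
    simpa using hf.fintype_card_le_finrank
  have := Y.rank_add_finrank_ker_vecMulLinear
  omega

theorem exists_frobenius_orthogonal {K F : Type*} [Field K] [Fintype K] [Field F] [Algebra K F]
    [FiniteDimensional K F] {k : ℕ} (hk : 0 < k) (c : Fin k → F) :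
    ∃ β : Fin k → F, β ≠ 0 ∧
      ∀ s, 0 < s → s < k → (fun l => β l ^ Fintype.card K ^ s) ⬝ᵥ c = 0 := by
  let φ := FiniteField.frobeniusAlgEquivOfAlgebraic K F
  let M : Matrix (Fin (k - 1)) (Fin k) F := Matrix.of fun s l => (φ.symm)^[s + 1] (c l)
  have hM : LinearMap.ker M.mulVecLin ≠ ⊥ := LinearMap.ker_ne_bot_of_finrank_lt (by simp; omega)
  obtain ⟨β, hβ, hβ0⟩ := Submodule.exists_mem_ne_zero_of_ne_bot hM
  refine ⟨β, hβ0, fun s hs hsk => ?_⟩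
  obtain ⟨s, rfl⟩ : ∃ t, s = t + 1 := ⟨s - 1, by omega⟩
  have h1 : ∑ l, (φ.symm)^[s + 1] (c l) * β l = 0 :=
    congrFun (LinearMap.mem_ker.1 hβ) ⟨s, by omega⟩
  have h2 := congrArg (φ ^ (s + 1)) h1
  have hpow (x : F) : (φ ^ (s + 1)) x = x ^ Fintype.card K ^ (s + 1) := by
    rw [AlgEquiv.coe_pow, FiniteField.coe_frobeniusAlgEquivOfAlgebraic_iterate]
  have hinv (x : F) : (φ ^ (s + 1)) ((φ.symm)^[s + 1] x) = x := by
    rw [AlgEquiv.coe_pow]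
    exact Function.LeftInverse.iterate (g := φ) (f := φ.symm) φ.apply_symm_apply (s + 1) x
  simp only [map_sum, map_mul, map_zero, hinv] at h2
  rw [← h2]
  simp only [dotProduct, hpow]
  exact Finset.sum_congr rfl fun l _ => mul_comm _ _

theorem exists_eq_vecMulVec_of_rank_eq_one {F : Type*} [Field F] {a b : ℕ}
    {Y : Matrix (Fin a) (Fin b) F} (hY : Y.rank = 1) : ∃ c w, Y = Matrix.vecMulVec c w := by
  rw [Matrix.rank_eq_finrank_span_cols] at hY
  obtain ⟨c, -, hc⟩ := finrank_eq_one_iff'.1 hY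
  choose w hw using fun j => hc ⟨Y.col j, Submodule.subset_span ⟨j, rfl⟩⟩
  refine ⟨c.1, w, ?_⟩
  ext i j
  have := congrFun (congrArg Subtype.val (hw j)) i
  simp [Matrix.vecMulVec_apply] at this ⊢
  rw [← this, mul_comm]

theorem exists_frobenius_iterates_mem {K F : Type*} [Field K] [Fintype K] [Field F] [Algebra K F]
    [FiniteDimensional K F] {n k : ℕ} (hk : 0 < k) (hkn : k ≤ n) {G : Matrix (Fin k) (Fin n) F}
    (hG : ∀ i : Fin k, ∀ j : Fin n, (j : ℕ) < k → G i j = if (j : ℕ) = (i : ℕ) then 1 else 0)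
    (hrank : (G - G.map (FiniteField.frobeniusAlgHom K F)).rank = 1) :
    ∃ α : Fin n → F, α ≠ 0 ∧
      ∀ i < k, (fun j => α j ^ Fintype.card K ^ i) ∈ Submodule.span F (Set.range G) := by
  let φ := FiniteField.frobeniusAlgHom K F
  obtain ⟨c, w, hcw⟩ := exists_eq_vecMulVec_of_rank_eq_one hrank
  obtain ⟨β, hβ0, hβ⟩ := exists_frobenius_orthogonal (K := K) hk c
  have hpow (i : ℕ) (hi : i < k) : (fun j => Matrix.vecMul β G j ^ Fintype.card K ^ i) =
      Matrix.vecMul (fun l => β l ^ Fintype.card K ^ i) G := by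
    induction i with
    | zero => simp
    | succ i ih =>
      have hsucc (x : F) : x ^ Fintype.card K ^ (i + 1) = φ (x ^ Fintype.card K ^ i) := by
        rw [pow_succ, pow_mul]
        rfl
      have h0 : Matrix.vecMul (fun l => β l ^ Fintype.card K ^ (i + 1))
          (G - G.map φ) = 0 := by
        rw [hcw, Matrix.vecMul_vecMulVec, hβ _ (by omega) hi, zero_smul]
      rw [Matrix.vecMul_sub, sub_eq_zero] at h0
      rw [h0]
      ext j
      rw [hsucc, congrFun (ih (by omega)) j]
      refine (RingHom.map_vecMul (φ : F →+* F) G _ j).trans ?_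
      congr 1
      ext l
      exact (hsucc _).symm
  refine ⟨Matrix.vecMul β G, fun h => hβ0 ?_, fun i hi => ?_⟩
  · ext i
    rw [← vecMul_castLE hkn hG β i, h]
    rfl
  · rw [hpow i hi]
    change _ ∈ Submodule.span F (Set.range G.row)
    rw [← range_vecMulLinear]
    exact ⟨_, rfl⟩

theorem statement_4
    (q m n k : ℕ) (hqp : IsPrimePow q) (hm : 0 < m)
    (hnm : n ≤ m) (hk3 : 3 ≤ k) (hkn : k < n)
    (Fq Fqm : Type) [Field Fq] [Fintype Fq] [Field Fqm] [Algebra Fq Fqm]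
    (hq : Fintype.card Fq = q) (hdeg : Module.finrank Fq Fqm = m)
    (C : Submodule Fqm (Fin n → Fqm))
    (hdim : Module.finrank Fqm C = k)
    (hMRD : Module.finrank Fqm C = n - minRankDist Fq Fqm C + 1)
    (G : Fin k → Fin n → Fqm)
    (hGgen : C = Submodule.span Fqm (Set.range G))
    (hGsys : ∀ i : Fin k, ∀ j : Fin n, (j : ℕ) < k →
      G i j = if (j : ℕ) = (i : ℕ) then 1 else 0) :
    (∃ α : Fin n → Fqm, LinearIndependent Fq α ∧
        C = Submodule.span Fqm
          (Set.range (fun i : Fin k => fun j : Fin n => α j ^ q ^ (i : ℕ)))) ↔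
      Module.finrank Fqm
          ↥(homogVanish Fqm k (q + 1)
            ((Submodule.span Fq (Set.range (fun j : Fin n => fun i => G i j)) :
              Submodule Fq (Fin k → Fqm)) : Set (Fin k → Fqm)))
        = Nat.choose (k - 1) 2 := by
  subst hq
  have hfin : FiniteDimensional Fq Fqm := Module.finite_of_finrank_pos (by omega)
  subst hGgen
  let G' : Matrix (Fin k) (Fin n) Fqm := G
  have hw (v : Fin n → Fqm) (hv : v ∈ Submodule.span Fqm (Set.range G)) (hv0 : v ≠ 0) :
      n - k + 1 ≤ rankWeight Fq Fqm v := by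
    have : minRankDist Fq Fqm (Submodule.span Fqm (Set.range G)) ≤ rankWeight Fq Fqm v :=
      Nat.sInf_le ⟨v, hv, hv0, rfl⟩
    omega
  have hrational (v : Fin n → Fqm) (hv : v ∈ Submodule.span Fqm (Set.range G)) (hv0 : v ≠ 0) :
      ¬ ∀ j, v j ∈ Set.range (algebraMap Fq Fqm) :=
    not_rational_of_two_le_rankWeight (by have := hw v hv hv0; omega)
  have hrow (i : Fin k) : G i ≠ 0 := fun h => by
    have := hGsys i (Fin.castLE hkn.le i) (by simp)
    simp [h] at this
  have hcol (i : Fin k) : ∃ j, (fun t => G' t j) = Pi.single i 1 := by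
    refine ⟨Fin.castLE hkn.le i, ?_⟩
    ext t
    simp [G', hGsys, Pi.single_apply, Fin.ext_iff, eq_comm]
  have hfinrank := finrank_homogVanish (K := Fq) G' hcol
  rw [show (fun (j : Fin n) i => G i j) = fun j i => G' i j from rfl, hfinrank,
    choose_two_sub_eq_iff hk3]
  constructor
  · rintro ⟨α, -, hα⟩
    refine le_antisymm (rank_sub_frobenius_le_one hkn.le hGsys hdim hα) ?_
    rw [Nat.one_le_iff_ne_zero]
    intro h0
    rw [Matrix.rank, Submodule.finrank_eq_zero, LinearMap.range_eq_bot] at h0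
    have h1 : G' - G'.map (FiniteField.frobeniusAlgHom Fq Fqm) = 0 :=
      Matrix.toLin'.injective (h0.trans (map_zero _).symm)
    rw [sub_eq_zero] at h1
    let i : Fin k := ⟨0, by omega⟩
    exact hrational (G i) (Submodule.subset_span ⟨i, rfl⟩) (hrow i) fun j =>
      mem_range_algebraMap_of_pow_card_eq (congrFun (congrFun h1 i) j).symm
  · intro hrank
    obtain ⟨α, hα0, hα⟩ := exists_frobenius_iterates_mem (by omega) hkn.le hGsys hrank
    have hli := linearIndependent_frobenius_iterates hrational hα0 k hα
    have hspan : Submodule.span Fqm (Set.range G) = Submodule.span Fqm (Set.range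
        fun (i : Fin k) (j : Fin n) => α j ^ Fintype.card Fq ^ (i : ℕ)) := by
      refine (Submodule.eq_of_le_of_finrank_eq (Submodule.span_le.2 ?_) ?_).symm
      · rintro _ ⟨i, rfl⟩
        exact hα i i.2
      · rw [hdim, finrank_span_eq_card hli, Fintype.card_fin]
    refine ⟨α, ?_, hspan⟩
    rw [Fintype.linearIndependent_iff]
    intro a ha
    refine congrFun (eq_zero_of_forall_relation (by omega) hkn.le hGsys
      (fun i => hw (G i) (Submodule.subset_span ⟨i, rfl⟩) (hrow i)) fun i => ?_)
    have hmem : G i ∈ Submodule.span Fqm (Set.range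
        fun (i : Fin k) (j : Fin n) => α j ^ Fintype.card Fq ^ (i : ℕ)) :=
      hspan ▸ Submodule.subset_span ⟨i, rfl⟩
    generalize G i = v at hmem
    induction hmem using Submodule.span_induction with
    | mem x hx =>
      obtain ⟨s, rfl⟩ := hx
      have := congrArg (FiniteField.frobeniusAlgEquivOfAlgebraic Fq Fqm ^ (s : ℕ)) ha
      simpa only [map_sum, map_smul, map_zero, AlgEquiv.coe_pow,
        FiniteField.coe_frobeniusAlgEquivOfAlgebraic_iterate] using this
    | zero => simp
    | add x y _ _ hx hy => simp [smul_add, Finset.sum_add_distrib, hx, hy]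
    | smul b x _ hx =>
      simp only [Pi.smul_apply, smul_comm _ b, ← Finset.smul_sum, hx, smul_zero]
end

section
/- Let q be a prime power, m,n,k integers with n ≤ m and 3 ≤ k < n, s ∈ {1,…,m−1} with gcd(s,m) = 1, and let C ⊆ F_{q^m}^n be an MRD code of dimension k with generator matrix G = [I_k | X] in systematic form. Let U be the F_q-span of the columns of G. Then C is a generalized Gabidulin code with parameter s if and only if the F_{q^m}-dimension of the subspace {p ∈ F_s : p(u) = 0 for all u ∈ U} equals C(k−1, 2). -/
open MvPolynomial

/-- The space `F_s`: the `F_{q^m}`-span of the forms `x_i^Q x_j - x_i x_j^Q` for `i < j`,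
where `Q = q^s`. -/
noncomputable def formSpace (Fqm : Type) [Field Fqm] (k Q : ℕ) :
    Submodule Fqm (MvPolynomial (Fin k) Fqm) :=
  Submodule.span Fqm {p | ∃ i j : Fin k, i < j ∧
    p = X i ^ Q * X j - X i * X j ^ Q}

section Semilinear

variable {K V : Type*} [Field K] [AddCommGroup V] [Module K V]
  {σ : K →+* K} [RingHomSurjective σ]

theorem finrank_map_semilinear (θ : V →ₛₗ[σ] V) (hθ : Function.Injective θ)
    (N : Submodule K V) : Module.finrank K (N.map θ) = Module.finrank K N := by
  have hσ : Function.Bijective σ := ⟨σ.injective, RingHomSurjective.is_surjective⟩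
  let j : N ≃+ N.map θ :=
    { toFun := fun x => ⟨θ x, Submodule.mem_map_of_mem x.2⟩
      invFun := fun y => ⟨y.2.choose, y.2.choose_spec.1⟩
      left_inv := fun x => Subtype.ext <| hθ <|
        (Submodule.mem_map_of_mem (f := θ) x.2).choose_spec.2
      right_inv := fun y => Subtype.ext y.2.choose_spec.2
      map_add' := fun x y => Subtype.ext (map_add θ _ _) }
  exact (congrArg Cardinal.toNat (rank_eq_of_equiv_equiv σ j hσ
    fun r m => Subtype.ext (θ.map_smulₛₗ r m))).symm

theorem finrank_inf_comap_semilinear (θ : V →ₛₗ[σ] V) (hθ : Function.Injective θ)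
    (N : Submodule K V) :
    Module.finrank K ↥(N ⊓ N.comap θ) = Module.finrank K ↥(N ⊓ N.map θ) := by
  rw [← finrank_map_semilinear θ hθ]
  suffices h : (N ⊓ N.comap θ).map θ = N ⊓ N.map θ by rw [h]
  ext x
  simp only [Submodule.mem_map, Submodule.mem_inf, Submodule.mem_comap]
  constructor
  · rintro ⟨y, ⟨h1, h2⟩, rfl⟩
    exact ⟨h2, y, h1, rfl⟩
  · rintro ⟨h2, y, h1, rfl⟩
    exact ⟨y, ⟨h1, h2⟩, rfl⟩

/-- If `C` contains no nonzero `θ`-stable subspace and `θ` moves `C` as little as possible, then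
`C` is spanned by the `θ`-orbit of a vector. -/
theorem exists_span_iterate_eq [FiniteDimensional K V]
    (θ : V →ₛₗ[σ] V) (hθ : Function.Injective θ) (k : ℕ) (C : Submodule K V)
    (hC : Module.finrank K C = k + 1)
    (hstable : ∀ N ≤ C, N.map θ ≤ N → N = ⊥)
    (hk : k ≤ Module.finrank K ↥(C ⊓ C.comap θ)) :
    ∃ v, C = Submodule.span K (Set.range fun i : Fin (k + 1) => θ^[i] v) := by
  induction k generalizing C with
  | zero =>
    obtain ⟨v, -, hv⟩ := finrank_eq_one_iff'.1 hC
    refine ⟨v, le_antisymm (fun w hw => ?_) (Submodule.span_le.2 ?_)⟩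
    · obtain ⟨c, hc⟩ := hv ⟨w, hw⟩
      rw [← show c • (v : V) = w from congrArg Subtype.val hc]
      exact Submodule.smul_mem _ _ (Submodule.subset_span ⟨0, rfl⟩)
    · rintro _ ⟨i, rfl⟩
      simp
  | succ k ih =>
    set D := C ⊓ C.comap θ with hD
    have hDC : D ≤ C := inf_le_left
    have hθD : D.map θ ≤ C := Submodule.map_le_iff_le_comap.2 inf_le_right
    have hne : D ≠ C := by
      intro h
      have := hstable C le_rfl (h ▸ hθD)
      rw [this] at hC
      simp at hC
    have hlt := Submodule.finrank_lt_finrank_of_lt (lt_of_le_of_ne hDC hne)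
    have hDfr : Module.finrank K D = k + 1 := by omega
    have hfm := finrank_map_semilinear θ hθ D
    have hsupinf := Submodule.finrank_sup_add_finrank_inf_eq D (D.map θ)
    have hle := Submodule.finrank_mono (sup_le hDC hθD)
    have hD2 := finrank_inf_comap_semilinear θ hθ D
    obtain ⟨v, hv⟩ := ih D hDfr (fun N hN => hstable N (hN.trans hDC)) (by omega)
    refine ⟨v, ?_⟩
    have hns : ¬ D.map θ ≤ D := by
      intro h
      rw [hstable D hDC h] at hDfr
      simp at hDfr
    have hlt2 := Submodule.finrank_lt_finrank_of_lt
      (left_lt_sup.2 hns)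
    have hsup : D ⊔ D.map θ = C := Submodule.eq_of_le_of_finrank_le (sup_le hDC hθD)
      (by rw [hC]; exact hDfr ▸ hlt2)
    rw [← hsup]
    have hvD : ∀ i : ℕ, i < k + 1 → θ^[i] v ∈ D := fun i hi => by
      rw [hv]; exact Submodule.subset_span ⟨⟨i, hi⟩, rfl⟩
    apply le_antisymm
    · refine sup_le ?_ ?_
      · rw [hv, Submodule.span_le]
        rintro _ ⟨i, rfl⟩
        exact Submodule.subset_span ⟨i.castSucc, rfl⟩
      · rw [hv, Submodule.map_span, Submodule.span_le]
        rintro _ ⟨_, ⟨i, rfl⟩, rfl⟩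
        exact Submodule.subset_span ⟨i.succ, by simp [Function.iterate_succ_apply']⟩
    · rw [Submodule.span_le]
      rintro _ ⟨i, rfl⟩
      obtain hi | hi := Nat.lt_or_ge i (k + 1)
      · exact Submodule.mem_sup_left (hvD i hi)
      · have : (i : ℕ) = k + 1 := by omega
        simp only [this, Function.iterate_succ_apply']
        exact Submodule.mem_sup_right (Submodule.mem_map_of_mem (hvD k (by omega)))

end Semilinear

section Coordinates

variable {K ι : Type*} [Field K] (σ : K →+* K)

/-- Coordinatewise application of a field endomorphism, as a semilinear map. -/
def coordMap (ι : Type*) : (ι → K) →ₛₗ[σ] (ι → K) where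
  toFun v i := σ (v i)
  map_add' v w := by ext; simp
  map_smul' c v := by ext; simp

@[simp] theorem coordMap_apply (v : ι → K) (i : ι) : coordMap σ ι v i = σ (v i) := rfl

theorem coordMap_injective : Function.Injective (coordMap σ ι) := fun _ _ h =>
  funext fun i => σ.injective (congrFun h i)

theorem exists_fixed_of_map_le [Fintype ι] [RingHomSurjective σ] (N : Submodule K (ι → K))
    (hN : N.map (coordMap σ ι) ≤ N) (h0 : N ≠ ⊥) :
    ∃ v ∈ N, v ≠ 0 ∧ ∀ i, σ (v i) = v i := by
  classical
  obtain ⟨v, hvN, hv0⟩ := Submodule.exists_mem_ne_zero_of_ne_bot h0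
  induction hc : (Finset.univ.filter fun i => v i ≠ 0).card using Nat.strong_induction_on
    generalizing v with
  | _ c ih =>
    obtain ⟨i, hi⟩ := Function.ne_iff.1 hv0
    simp only [Pi.zero_apply] at hi
    set w : ι → K := (v i)⁻¹ • v with hw
    have hwN : w ∈ N := N.smul_mem _ hvN
    have hwi : w i = 1 := by simp [hw, hi]
    by_cases hfix : coordMap σ ι w - w = 0
    · refine ⟨w, hwN, fun h => by simp [h] at hwi, fun j => ?_⟩
      simpa [sub_eq_zero] using congrFun hfix j
    · refine ih _ ?_ _ (N.sub_mem (hN (Submodule.mem_map_of_mem hwN)) hwN) hfix rfl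
      rw [← hc]
      apply Finset.card_lt_card
      rw [Finset.ssubset_iff_of_subset]
      · exact ⟨i, by simpa using hi, fun h => (Finset.mem_filter.1 h).2 (by simp [hwi])⟩
      · intro j
        simp only [Finset.mem_filter, Finset.mem_univ, true_and]
        intro hj h
        exact hj (by simp [hw, h])

end Coordinates

theorem mem_range_algebraMap_of_pow_eq {F K : Type*} [Field F] [Fintype F] [Field K] [Algebra F K]
    [FiniteDimensional F K] {s : ℕ} (hs : Nat.Coprime s (Module.finrank F K)) {x : K}
    (hx : x ^ Fintype.card F ^ s = x) : x ∈ Set.range (algebraMap F K) := by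
  have : Finite K := Module.finite_of_finite F
  have := Fintype.ofFinite K
  have h1 : Function.IsPeriodicPt (fun y : K => y ^ Fintype.card F) s x := by
    simpa [Function.IsPeriodicPt, Function.IsFixedPt, pow_iterate] using hx
  have h2 : Function.IsPeriodicPt (fun y : K => y ^ Fintype.card F) (Module.finrank F K) x := by
    simp [Function.IsPeriodicPt, Function.IsFixedPt, pow_iterate, ← Module.card_eq_pow_finrank,
      FiniteField.pow_card]
  have h3 := h1.gcd h2
  rw [hs.gcd_eq_one] at h3
  rw [← IntermediateField.coe_bot, SetLike.mem_coe, IsGalois.mem_bot_iff_fixed]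
  intro f
  obtain ⟨i, rfl⟩ := (FiniteField.bijective_frobeniusAlgEquivOfAlgebraic_pow F K).2 f
  have h4 := h3.const_mul i
  rw [mul_one] at h4
  simpa [AlgEquiv.coe_pow, FiniteField.coe_frobeniusAlgEquivOfAlgebraic, pow_iterate,
    Function.IsPeriodicPt, Function.IsFixedPt] using h4

section AlternatingForms

variable {K V : Type*} [Field K] [AddCommGroup V] [Module K V]

/-- The bilinear form underlying an alternating `2`-form. -/
def AlternatingMap.toBilin (f : V [⋀^Fin 2]→ₗ[K] K) : V →ₗ[K] V →ₗ[K] K :=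
  LinearMap.mk₂ K (fun v w => f ![v, w])
    (fun v v' w => f.map_vecCons_add ![w] v v') (fun c v w => f.map_vecCons_smul ![w] c v)
    (fun v w w' => by
      have h (x : V) : Function.update ![v, 0] 1 x = ![v, x] := by ext i; fin_cases i <;> rfl
      simpa only [h] using f.map_update_add ![v, 0] 1 w w')
    (fun c v w => by
      have h (x : V) : Function.update ![v, 0] 1 x = ![v, x] := by ext i; fin_cases i <;> rfl
      simpa only [h] using f.map_update_smul ![v, 0] 1 c w)

theorem AlternatingMap.toBilin_injective :
    Function.Injective (AlternatingMap.toBilin : (V [⋀^Fin 2]→ₗ[K] K) → V →ₗ[K] V →ₗ[K] K) := by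
  intro f g h
  ext v
  rw [show v = ![v 0, v 1] from List.ofFn_inj.1 rfl]
  exact LinearMap.congr_fun₂ h (v 0) (v 1)

theorem AlternatingMap.toBilin_apply (f : V [⋀^Fin 2]→ₗ[K] K) (v w : V) :
    f.toBilin v w = f ![v, w] := rfl

theorem AlternatingMap.toBilin_self (f : V [⋀^Fin 2]→ₗ[K] K) (v : V) : f.toBilin v v = 0 :=
  f.map_eq_zero_of_eq (i := 0) (j := 1) _ rfl (by decide)

theorem AlternatingMap.toBilin_swap (f : V [⋀^Fin 2]→ₗ[K] K) (v w : V) :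
    f.toBilin v w = -f.toBilin w v :=
  ((show LinearMap.IsAlt f.toBilin from f.toBilin_self).neg w v).symm

theorem finrank_alternatingMap_two [FiniteDimensional K V] :
    Module.finrank K (V [⋀^Fin 2]→ₗ[K] K) = (Module.finrank K V).choose 2 := by
  rw [(exteriorPower.alternatingMapLinearEquiv (R := K) (M := V) (N := K)
    (n := 2)).finrank_eq]
  exact Subspace.dual_finrank_eq.trans (exteriorPower.finrank_eq K 2)

end AlternatingForms

section FormPolynomials

variable {K : Type} [Field K] {k : ℕ}

/-- The form `∑ f(e_i, e_j) x_i^Q x_j` attached to an alternating `2`-form `f`. -/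
noncomputable def altPoly (K : Type) [Field K] (k Q : ℕ) :
    ((Fin k → K) [⋀^Fin 2]→ₗ[K] K) →ₗ[K] MvPolynomial (Fin k) K where
  toFun f := ∑ i, ∑ j, f.toBilin (Pi.single i 1) (Pi.single j 1) • (X i ^ Q * X j)
  map_add' f g := by
    simp [AlternatingMap.toBilin_apply, add_smul, Finset.sum_add_distrib]
  map_smul' c f := by
    simp [AlternatingMap.toBilin_apply, mul_smul, Finset.smul_sum]

theorem altPoly_apply (Q : ℕ) (f : (Fin k → K) [⋀^Fin 2]→ₗ[K] K) :
    altPoly K k Q f = ∑ i, ∑ j, f.toBilin (Pi.single i 1) (Pi.single j 1) • (X i ^ Q * X j) := rfl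

theorem aeval_altPoly {Q : ℕ} {σ : K →+* K} (hσ : ∀ x, σ x = x ^ Q)
    (f : (Fin k → K) [⋀^Fin 2]→ₗ[K] K) (u : Fin k → K) :
    aeval u (altPoly K k Q f) = f.toBilin (coordMap σ _ u) u := by
  have hexp {M : Type} [AddCommGroup M] [Module K M] (g : (Fin k → K) →ₗ[K] M) (v : Fin k → K) :
      g v = ∑ i, v i • g (Pi.single i 1) := by
    conv_lhs => rw [← Finset.univ_sum_single v, map_sum]
    refine Finset.sum_congr rfl fun i _ => ?_
    rw [← map_smul, ← Pi.single_smul, smul_eq_mul, mul_one]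
  rw [hexp f.toBilin, LinearMap.sum_apply]
  simp only [altPoly_apply, map_sum]
  refine Finset.sum_congr rfl fun i _ => ?_
  rw [LinearMap.smul_apply, hexp (f.toBilin _) u, Finset.smul_sum]
  refine Finset.sum_congr rfl fun j _ => ?_
  simp only [map_smul, map_mul, map_pow, aeval_X, coordMap_apply, hσ, smul_eq_mul]
  ring

theorem altPoly_injective {Q : ℕ} (hQ : 2 ≤ Q) : Function.Injective (altPoly K k Q) := by
  classical
  rw [injective_iff_map_eq_zero]
  intro f hf
  have key (a b : Fin k) : f.toBilin (Pi.single a 1) (Pi.single b 1) = 0 := by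
    have h := congrArg (coeff (Finsupp.single a Q + Finsupp.single b 1)) hf
    have hmon (i j : Fin k) : (X i ^ Q * X j : MvPolynomial (Fin k) K) =
        monomial (Finsupp.single i Q + Finsupp.single j 1) 1 := by
      rw [X_pow_eq_monomial, X, monomial_mul, one_mul]
    have hinj (i j : Fin k) : Finsupp.single i Q + Finsupp.single j 1 =
        Finsupp.single a Q + Finsupp.single b 1 ↔ i = a ∧ j = b := by
      refine ⟨fun h => ?_, fun ⟨h1, h2⟩ => by rw [h1, h2]⟩
      have h1 : i = a := by
        by_contra hne
        have := DFunLike.congr_fun h a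
        simp only [Finsupp.add_apply, Finsupp.single_apply, hne, if_true, if_false] at this
        split_ifs at this <;> omega
      subst h1
      exact ⟨rfl, (Finsupp.single_left_injective one_ne_zero) (add_left_cancel h)⟩
    simp only [altPoly_apply, hmon, coeff_sum, coeff_smul, coeff_monomial, hinj, coeff_zero] at h
    rw [Finset.sum_eq_single a (by simp +contextual) (by simp),
      Finset.sum_eq_single b (by simp +contextual) (by simp)] at h
    simpa using h
  have hB : f.toBilin = 0 := by
    refine LinearMap.pi_ext' fun i => LinearMap.ext_ring ?_
    refine LinearMap.pi_ext' fun j => LinearMap.ext_ring ?_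
    simpa using key i j
  exact AlternatingMap.toBilin_injective (hB.trans (by ext; rfl))

theorem range_altPoly (Q : ℕ) : LinearMap.range (altPoly K k Q) = formSpace K k Q := by
  apply le_antisymm
  · rintro _ ⟨f, rfl⟩
    have h : altPoly K k Q f = ∑ i : Fin k, ∑ j : Fin k, if i < j then
        f.toBilin (Pi.single i 1) (Pi.single j 1) • (X i ^ Q * X j - X i * X j ^ Q) else 0 := by
      have h1 : ∑ i : Fin k, ∑ j : Fin k, (if i < j then
          f.toBilin (Pi.single i 1) (Pi.single j 1) • (X i * X j ^ Q) else 0) =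
          ∑ i : Fin k, ∑ j : Fin k, (if j < i then
          -(f.toBilin (Pi.single i 1) (Pi.single j 1) • (X i ^ Q * X j)) else 0 :
            MvPolynomial (Fin k) K) := by
        rw [Finset.sum_comm]
        refine Finset.sum_congr rfl fun i _ => Finset.sum_congr rfl fun j _ => ?_
        rw [f.toBilin_swap (Pi.single j 1), neg_smul, mul_comm (X j)]
      have h2 : (∑ i : Fin k, ∑ j : Fin k, if i < j then
          f.toBilin (Pi.single i 1) (Pi.single j 1) •
            (X i ^ Q * X j - X i * X j ^ Q : MvPolynomial (Fin k) K) else 0) =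
          (∑ i : Fin k, ∑ j : Fin k, if i < j then
          f.toBilin (Pi.single i 1) (Pi.single j 1) • (X i ^ Q * X j) else 0) -
          ∑ i : Fin k, ∑ j : Fin k, (if i < j then
          f.toBilin (Pi.single i 1) (Pi.single j 1) • (X i * X j ^ Q) else 0) := by
        simp only [← Finset.sum_sub_distrib]
        refine Finset.sum_congr rfl fun i _ => Finset.sum_congr rfl fun j _ => ?_
        split_ifs <;> simp [smul_sub]
      rw [h2, h1, altPoly_apply]
      simp only [← Finset.sum_sub_distrib]
      refine Finset.sum_congr rfl fun i _ => Finset.sum_congr rfl fun j _ => ?_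
      rcases lt_trichotomy i j with h | rfl | h
      · simp [h, h.not_gt]
      · simp [f.toBilin_self]
      · simp [h, h.not_gt]
    rw [h]
    refine Submodule.sum_mem _ fun i _ => Submodule.sum_mem _ fun j _ => ?_
    split_ifs with hij
    · exact Submodule.smul_mem _ _ (Submodule.subset_span ⟨i, j, hij, rfl⟩)
    · exact Submodule.zero_mem _
  · rw [formSpace, Submodule.span_le]
    rintro _ ⟨i, j, hij, rfl⟩
    refine ⟨(Matrix.detRowAlternating (n := Fin 2) (R := K)).compLinearMap
      (LinearMap.funLeft K K ![i, j]), ?_⟩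
    have hB (a b : Fin k) : ((Matrix.detRowAlternating (n := Fin 2) (R := K)).compLinearMap
        (LinearMap.funLeft K K ![i, j])).toBilin (Pi.single a 1)
        (Pi.single b 1) = (if a = i ∧ b = j then 1 else 0) - if a = j ∧ b = i then 1 else 0 := by
      rw [AlternatingMap.toBilin_apply]
      refine (Matrix.det_fin_two _).trans ?_
      simp [Pi.single_apply, LinearMap.funLeft_apply, ite_and]
      grind
    simp only [altPoly_apply, hB, sub_smul, Finset.sum_sub_distrib, ite_smul, one_smul, zero_smul,
      ite_and]
    simp [mul_comm]

theorem finrank_vanishing_forms {F : Type*} [Field F] [Algebra F K] {Q : ℕ} (hQ : 2 ≤ Q)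
    {σ : K →+* K} (hσ : ∀ x, σ x = x ^ Q) (U : Submodule F (Fin k → K))
    (hU : ∀ i, Pi.single i 1 ∈ U) (W : Submodule K (Fin k → K))
    (hW : W = Submodule.span K ((fun u => coordMap σ _ u - u) '' (U : Set (Fin k → K)))) :
    Module.finrank K ↥(formSpace K k Q ⊓ ⨅ u ∈ (U : Set (Fin k → K)),
      LinearMap.ker (aeval (R := K) u).toLinearMap) = (k - Module.finrank K W).choose 2 := by
  obtain ⟨W', hc⟩ := Submodule.exists_isCompl W
  have hc' := hc.symm
  let P := W'.projectionOnto W hc'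
  let comp : (W' [⋀^Fin 2]→ₗ[K] K) →ₗ[K] (Fin k → K) [⋀^Fin 2]→ₗ[K] K :=
    { toFun := fun g => g.compLinearMap P
      map_add' := fun g g' => AlternatingMap.add_compLinearMap g g' P
      map_smul' := fun _ _ => rfl }
  have hcomp (g) (v w) : (comp g).toBilin v w = g.toBilin (P v) (P w) :=
    congrArg g (List.ofFn_inj.1 rfl)
  have hinj : Function.Injective ((altPoly K k Q).comp comp) :=
    (altPoly_injective hQ).comp (AlternatingMap.compLinearMap_injective P
      (Submodule.projectionOnto_surjective hc'))
  have hrange : LinearMap.range ((altPoly K k Q).comp comp) =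
      formSpace K k Q ⊓ ⨅ u ∈ (U : Set (Fin k → K)),
        LinearMap.ker (aeval (R := K) u).toLinearMap := by
    rw [← range_altPoly]
    ext p
    simp only [Submodule.mem_inf, Submodule.mem_iInf, LinearMap.mem_ker, LinearMap.mem_range,
      SetLike.mem_coe, AlgHom.toLinearMap_apply]
    constructor
    · rintro ⟨g, rfl⟩
      refine ⟨⟨comp g, rfl⟩, fun u hu => ?_⟩
      have hmem : coordMap σ _ u - u ∈ W := hW ▸ Submodule.subset_span ⟨u, hu, rfl⟩
      have hP : P (coordMap σ _ u) = P u := by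
        rw [← sub_eq_zero, ← map_sub]
        exact (Submodule.projectionOnto_apply_eq_zero_iff hc').2 hmem
      rw [LinearMap.comp_apply, aeval_altPoly hσ, hcomp, hP, AlternatingMap.toBilin_self]
    · rintro ⟨⟨f, rfl⟩, hf⟩
      replace hf : ∀ u ∈ U, f.toBilin (coordMap σ _ u) u = 0 := fun u hu => by
        rw [← aeval_altPoly hσ, hf u hu]
      have hWf : ∀ w ∈ W, f.toBilin w = 0 := by
        suffices W ≤ LinearMap.ker f.toBilin from fun w hw => this hw
        rw [hW, Submodule.span_le]
        rintro _ ⟨u, hu, rfl⟩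
        refine LinearMap.pi_ext' fun i => LinearMap.ext_ring ?_
        have hfix : coordMap σ _ (Pi.single i 1 : Fin k → K) = Pi.single i 1 := by
          ext j
          by_cases h : j = i <;> simp [h]
        have h := hf _ (U.add_mem hu (hU i))
        simp only [map_add, LinearMap.add_apply, hfix, hf u hu, f.toBilin_self, zero_add,
          add_zero] at h
        rw [f.toBilin_swap (Pi.single i 1), neg_add_eq_sub] at h
        simpa using h
      suffices h : comp (f.compLinearMap W'.subtype) = f from
        ⟨f.compLinearMap W'.subtype, congrArg (altPoly K k Q) h⟩
      apply AlternatingMap.toBilin_injective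
      have hsub (v : Fin k → K) : f.toBilin v = f.toBilin (P v) := by
        rw [← sub_eq_zero, ← map_sub]
        refine hWf _ ((Submodule.projectionOnto_apply_eq_zero_iff hc').1 ?_)
        rw [map_sub, Submodule.projectionOnto_apply_left, sub_self]
      refine LinearMap.ext₂ fun v w => ?_
      have h1 : (f.compLinearMap W'.subtype).toBilin (P v) (P w) = f.toBilin (P v) (P w) :=
        congrArg f (List.ofFn_inj.1 rfl)
      rw [hcomp, h1, hsub v, f.toBilin_swap _ w, hsub w, ← f.toBilin_swap]
  rw [← hrange, LinearMap.finrank_range_of_inj hinj, finrank_alternatingMap_two]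
  congr 1
  have := Submodule.finrank_add_eq_of_isCompl hc
  rw [Module.finrank_fin_fun] at this
  omega

end FormPolynomials

section Codes

variable {F K : Type} [Field F] [Field K] [Algebra F K] {k n : ℕ}

theorem minRankDist_le {C : Submodule K (Fin n → K)} {v : Fin n → K} (hv : v ∈ C) (h0 : v ≠ 0) :
    minRankDist F K C ≤ rankWeight F K v :=
  Nat.sInf_le ⟨v, hv, h0, rfl⟩

theorem rankWeight_le_one {v : Fin n → K} (hv : ∀ i, v i ∈ Set.range (algebraMap F K)) :
    rankWeight F K v ≤ 1 := by
  have h : Submodule.span F (Set.range v) ≤ Submodule.span F (({1} : Finset K) : Set K) := by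
    rw [Submodule.span_le]
    rintro _ ⟨i, rfl⟩
    obtain ⟨c, hc⟩ := hv i
    rw [← hc, Algebra.algebraMap_eq_smul_one]
    exact Submodule.smul_mem _ _ (Submodule.subset_span (by simp))
  exact (Submodule.finrank_mono h).trans (finrank_span_finset_le_card _)

/-- The rows of `G` begin with the identity matrix. -/
def IsSystematic (G : Fin k → Fin n → K) : Prop :=
  ∀ i : Fin k, ∀ j : Fin n, (j : ℕ) < k → G i j = if (j : ℕ) = (i : ℕ) then 1 else 0

theorem IsSystematic.eq_zero {G : Fin k → Fin n → K} (hG : IsSystematic G) (hkn : k ≤ n)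
    {v : Fin n → K} (hv : v ∈ Submodule.span K (Set.range G))
    (h0 : ∀ j : Fin n, (j : ℕ) < k → v j = 0) : v = 0 := by
  obtain ⟨c, rfl⟩ := (Submodule.mem_span_range_iff_exists_fun K).1 hv
  have hc (i : Fin k) : c i = 0 := by
    have h := h0 (Fin.castLE hkn i) i.2
    simp only [Finset.sum_apply, Pi.smul_apply, smul_eq_mul] at h
    rw [Finset.sum_eq_single i] at h
    · simpa [hG i (Fin.castLE hkn i) i.2] using h
    · intro b _ hb
      rw [hG b _ i.2, if_neg (by simpa [Fin.ext_iff] using hb.symm), mul_zero]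
    · simp
  simp [hc]

/-- If the entries of all codewords satisfy a common nontrivial `F`-linear relation, then the rows
of a systematic generator matrix have smaller rank weight than the Singleton bound allows. -/
theorem IsSystematic.eq_zero_of_relation {G : Fin k → Fin n → K} (hG : IsSystematic G)
    (hkn : k ≤ n) (i : Fin k) (hw : n - k < rankWeight F K (G i)) (l : Fin n → F)
    (hl : ∀ r, ∑ j, l j • G r j = 0) : l = 0 := by
  classical
  by_contra hne
  obtain ⟨j₀, hj₀k, hj₀⟩ : ∃ j : Fin n, k ≤ j ∧ l j ≠ 0 := by
    by_contra! hall
    apply hne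
    funext j
    by_cases hj : k ≤ j
    · exact hall j hj
    · have h := hl ⟨j, not_le.1 hj⟩
      rw [Finset.sum_eq_single j] at h
      · rw [hG _ j (not_le.1 hj), if_pos rfl] at h
        simpa using h
      · intro b _ hb
        by_cases hbk : k ≤ b
        · rw [hall b hbk, zero_smul]
        · rw [hG _ b (not_le.1 hbk), if_neg (by simpa [Fin.ext_iff] using hb), smul_zero]
      · simp
  set S : Finset (Fin n) := insert (Fin.castLE hkn i)
    ((Finset.univ.filter fun j : Fin n => k ≤ j).erase j₀) with hS
  have hScard : S.card ≤ n - k := by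
    have h1 : (Finset.univ.filter fun j : Fin n => k ≤ j).card = n - k := by
      rw [← Finset.card_map Fin.valEmbedding, ← Nat.card_Ico]
      congr 1
      ext j
      simp only [Finset.mem_map, Finset.mem_filter, Finset.mem_univ, true_and, Finset.mem_Ico,
        Fin.valEmbedding_apply]
      exact ⟨fun ⟨a, h, ha⟩ => ha ▸ ⟨h, a.2⟩, fun h => ⟨⟨j, h.2⟩, h.1, rfl⟩⟩
    refine (Finset.card_insert_le _ _).trans ?_
    have hmem : j₀ ∈ Finset.univ.filter fun j : Fin n => k ≤ j := by simpa using hj₀k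
    rw [Finset.card_erase_add_one hmem, h1]
  have hne_mem (j : Fin n) (hj : j ≠ j₀) :
      G i j ∈ Submodule.span F ((S.image (G i) : Finset K) : Set K) := by
    by_cases hjS : j ∈ S
    · exact Submodule.subset_span (Finset.mem_coe.2 (Finset.mem_image_of_mem _ hjS))
    · have hjk : (j : ℕ) < k := by
        by_contra h
        exact hjS (by simp [hS, hj, not_lt.1 h])
      have hji : (j : ℕ) ≠ i := fun h => hjS (by simp [hS, Fin.ext_iff, h])
      rw [hG i j hjk, if_neg hji]
      exact Submodule.zero_mem _
  have hle : Submodule.span F (Set.range (G i)) ≤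
      Submodule.span F ((S.image (G i) : Finset K) : Set K) := by
    rw [Submodule.span_le]
    rintro _ ⟨j, rfl⟩
    by_cases hj : j = j₀
    · subst hj
      have h := hl i
      rw [← Finset.add_sum_erase _ _ (Finset.mem_univ j)] at h
      have h' : G i j = (l j)⁻¹ • -∑ x ∈ Finset.univ.erase j, l x • G i x := by
        rw [eq_inv_smul_iff₀ hj₀]
        exact eq_neg_of_add_eq_zero_left h
      rw [SetLike.mem_coe, h']
      exact Submodule.smul_mem _ _ (Submodule.neg_mem _ (Submodule.sum_mem _ fun x hx =>
        Submodule.smul_mem _ _ (hne_mem x (Finset.ne_of_mem_erase hx))))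
    · exact hne_mem j hj
  have := (Submodule.finrank_mono hle).trans (finrank_span_finset_le_card _)
  have := Finset.card_image_le (s := S) (f := G i)
  unfold rankWeight at hw
  omega

/-- The span of the rows of `θ(G) - G`. -/
def rowDefect (σ : K →+* K) (G : Fin k → Fin n → K) : Submodule K (Fin n → K) :=
  Submodule.span K (Set.range fun i => coordMap σ _ (G i) - G i)

theorem finrank_rowDefect (φ : K →ₐ[F] K) (G : Fin k → Fin n → K) :
    Module.finrank K ↥(Submodule.span K ((fun u => coordMap (φ : K →+* K) _ u - u) ''
      (Submodule.span F (Set.range fun j : Fin n => fun i => G i j) : Set (Fin k → K)))) =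
    Module.finrank K (rowDefect (φ : K →+* K) G) := by
  let M : Matrix (Fin k) (Fin n) K := Matrix.of fun i j => φ (G i j) - G i j
  have hrow := M.rank_eq_finrank_span_row
  rw [M.rank_eq_finrank_span_cols] at hrow
  refine Eq.trans ?_ hrow
  suffices h : Submodule.span K ((fun u => coordMap (φ : K →+* K) _ u - u) ''
      (Submodule.span F (Set.range fun j : Fin n => fun i => G i j) : Set (Fin k → K))) =
      Submodule.span K (Set.range M.col) by rw [h]
  apply le_antisymm
  · rw [Submodule.span_le]
    rintro _ ⟨u, hu, rfl⟩
    induction hu using Submodule.span_induction with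
    | mem u hu =>
      obtain ⟨j, rfl⟩ := hu
      exact Submodule.subset_span ⟨j, rfl⟩
    | zero => simp
    | add u v _ _ hu hv =>
      have : coordMap (φ : K →+* K) _ (u + v) - (u + v) =
        (coordMap (φ : K →+* K) _ u - u) + (coordMap (φ : K →+* K) _ v - v) := by
        rw [map_add]; abel
      simp only [this]
      exact Submodule.add_mem _ hu hv
    | smul c u _ hu =>
      have : coordMap (φ : K →+* K) _ (c • u) - c • u =
        algebraMap F K c • (coordMap (φ : K →+* K) _ u - u) := by
        ext i; simp [mul_sub, Algebra.smul_def]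
      simp only [this]
      exact Submodule.smul_mem _ _ hu
  · refine Submodule.span_mono ?_
    rintro _ ⟨j, rfl⟩
    exact ⟨_, Submodule.subset_span ⟨j, rfl⟩, rfl⟩

variable {σ : K →+* K} [RingHomSurjective σ]

theorem span_sup_rowDefect (G : Fin k → Fin n → K) :
    Submodule.span K (Set.range G) ⊔ rowDefect σ G =
      Submodule.span K (Set.range G) ⊔ (Submodule.span K (Set.range G)).map (coordMap σ _) := by
  have hG (i) : G i ∈ Submodule.span K (Set.range G) := Submodule.subset_span ⟨i, rfl⟩
  apply le_antisymm
  · refine sup_le le_sup_left ?_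
    rw [rowDefect, Submodule.span_le]
    rintro _ ⟨i, rfl⟩
    exact Submodule.sub_mem _ (Submodule.mem_sup_right (Submodule.mem_map_of_mem (hG i)))
      (Submodule.mem_sup_left (hG i))
  · refine sup_le le_sup_left ?_
    rw [Submodule.map_span, Submodule.span_le]
    rintro _ ⟨_, ⟨i, rfl⟩, rfl⟩
    rw [← sub_add_cancel (coordMap σ _ (G i)) (G i)]
    exact Submodule.add_mem _ (Submodule.mem_sup_right (Submodule.subset_span ⟨i, rfl⟩))
      (Submodule.mem_sup_left (hG i))

theorem IsSystematic.finrank_sup_map {G : Fin k → Fin n → K} (hG : IsSystematic G) (hkn : k ≤ n) :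
    Module.finrank K ↥(Submodule.span K (Set.range G) ⊔
      (Submodule.span K (Set.range G)).map (coordMap σ _)) =
      Module.finrank K (Submodule.span K (Set.range G)) + Module.finrank K (rowDefect σ G) := by
  rw [← span_sup_rowDefect, ← Submodule.finrank_sup_add_finrank_inf_eq]
  suffices h : Submodule.span K (Set.range G) ⊓ rowDefect σ G = ⊥ by simp [h]
  rw [Submodule.eq_bot_iff]
  rintro v ⟨hv, hv'⟩
  refine hG.eq_zero hkn hv fun j hj => ?_
  suffices rowDefect σ G ≤ LinearMap.ker (LinearMap.proj (R := K) (φ := fun _ => K) j) from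
    this hv'
  rw [rowDefect, Submodule.span_le]
  rintro _ ⟨i, rfl⟩
  simp only [SetLike.mem_coe, LinearMap.mem_ker, LinearMap.proj_apply, Pi.sub_apply,
    coordMap_apply, hG i j hj]
  split_ifs <;> simp

end Codes

theorem statement_5
    (q m n k s : ℕ) (hqp : IsPrimePow q) (hm : 0 < m)
    (hnm : n ≤ m) (hk3 : 3 ≤ k) (hkn : k < n)
    (hs1 : 1 ≤ s) (hs2 : s ≤ m - 1) (hgcd : Nat.gcd s m = 1)
    (Fq Fqm : Type) [Field Fq] [Fintype Fq] [Field Fqm] [Algebra Fq Fqm]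
    (hq : Fintype.card Fq = q) (hdeg : Module.finrank Fq Fqm = m)
    (C : Submodule Fqm (Fin n → Fqm))
    (hdim : Module.finrank Fqm C = k)
    (hMRD : Module.finrank Fqm C = n - minRankDist Fq Fqm C + 1)
    (G : Fin k → Fin n → Fqm)
    (hGgen : C = Submodule.span Fqm (Set.range G))
    (hGsys : ∀ i : Fin k, ∀ j : Fin n, (j : ℕ) < k →
      G i j = if (j : ℕ) = (i : ℕ) then 1 else 0) :
    (∃ α : Fin n → Fqm, LinearIndependent Fq α ∧
        C = Submodule.span Fqm
          (Set.range (fun i : Fin k => fun j : Fin n => α j ^ q ^ (s * (i : ℕ))))) ↔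
      Module.finrank Fqm
          ↥(formSpace Fqm k (q ^ s) ⊓
            ⨅ u ∈ ((Submodule.span Fq (Set.range (fun j : Fin n => fun i => G i j)) :
                Submodule Fq (Fin k → Fqm)) : Set (Fin k → Fqm)),
              LinearMap.ker (aeval (R := Fqm) u).toLinearMap)
        = Nat.choose (k - 1) 2 := by
  have hK : FiniteDimensional Fq Fqm := Module.finite_of_finrank_pos (by omega)
  have : Finite Fqm := Module.finite_of_finite Fq
  let φ : Fqm →ₐ[Fq] Fqm := FiniteField.frobeniusAlgHom Fq Fqm ^ s
  have hφ (x : Fqm) : φ x = x ^ q ^ s := by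
    simp [φ, AlgHom.coe_pow, FiniteField.coe_frobeniusAlgHom, pow_iterate, hq]
  set σ : Fqm →+* Fqm := (φ : Fqm →+* Fqm) with hσ
  have hσφ (x : Fqm) : σ x = x ^ q ^ s := hφ x
  have : RingHomSurjective σ := ⟨Finite.surjective_of_injective σ.injective⟩
  have hG : IsSystematic G := hGsys
  have hweight (v : Fin n → Fqm) (hv : v ∈ C) (h0 : v ≠ 0) : n - k < rankWeight Fq Fqm v := by
    have := minRankDist_le (F := Fq) hv h0
    omega
  have hfixed (v : Fin n → Fqm) (hv : v ∈ C) (hfix : ∀ i, σ (v i) = v i) : v = 0 := by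
    by_contra h0
    have h1 := hweight v hv h0
    have h2 : rankWeight Fq Fqm v ≤ 1 := rankWeight_le_one fun i =>
      mem_range_algebraMap_of_pow_eq (hdeg.symm ▸ hgcd) (by rw [hq, ← hσφ, hfix])
    omega
  have hstable : ∀ N ≤ C, N.map (coordMap σ _) ≤ N → N = ⊥ := by
    intro N hNC hN
    by_contra h
    obtain ⟨v, hv, h0, hfix⟩ := exists_fixed_of_map_le σ N hN h
    exact h0 (hfixed v (hNC hv) hfix)
  have hrow (i : Fin k) : G i ∈ C := hGgen ▸ Submodule.subset_span ⟨i, rfl⟩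
  have hrow0 : G ⟨0, by omega⟩ ≠ 0 := fun h => by
    simpa [h] using hG ⟨0, by omega⟩ ⟨0, by omega⟩ (by simp; omega)
  have hpos : Module.finrank Fqm (rowDefect σ G) ≠ 0 := by
    intro h
    rw [Submodule.finrank_eq_zero, rowDefect, Submodule.span_eq_bot] at h
    refine hrow0 (hfixed _ (hrow _) fun j => ?_)
    simpa [sub_eq_zero] using congrFun (h _ ⟨⟨0, by omega⟩, rfl⟩) j
  have hsup := hG.finrank_sup_map (σ := σ) hkn.le
  rw [← hGgen, hdim] at hsup
  have hQ : 2 ≤ q ^ s := hqp.two_le.trans (Nat.le_self_pow (by omega) q)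
  rw [finrank_vanishing_forms hQ hσφ _ (fun i => ?_) _ rfl, finrank_rowDefect φ G, ← hσ]
  swap
  · refine Submodule.subset_span ⟨Fin.castLE hkn.le i, ?_⟩
    ext r
    simp [hG r (Fin.castLE hkn.le i) i.2, Pi.single_apply, Fin.ext_iff, eq_comm]
  have hchoose : (k - Module.finrank Fqm (rowDefect σ G)).choose 2 = (k - 1).choose 2 ↔
      Module.finrank Fqm (rowDefect σ G) = 1 := by
    refine ⟨fun h => ?_, fun h => by rw [h]⟩
    by_contra hne
    have hlt : k - Module.finrank Fqm (rowDefect σ G) < k - 1 := by omega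
    have h1 : (k - Module.finrank Fqm (rowDefect σ G)).choose 2 ≤ (k - 2).choose 2 :=
      Nat.choose_le_choose 2 (by omega)
    have h2 : (k - 1).choose 2 = (k - 2).choose 1 + (k - 2).choose 2 := by
      rw [← Nat.choose_succ_succ' (k - 2) 1]
      congr 1
      omega
    rw [Nat.choose_one_right] at h2
    omega
  have hiter (v : Fin n → Fqm) (i : ℕ) : (coordMap σ _)^[i] v = fun j => v j ^ q ^ (s * i) := by
    induction i with
    | zero => simp
    | succ i ih =>
      rw [Function.iterate_succ_apply', ih]
      ext j
      rw [coordMap_apply, hσφ, ← pow_mul, ← pow_add, mul_add_one]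
  rw [hchoose]
  constructor
  · rintro ⟨α, -, hα⟩
    have hle : C ⊔ C.map (coordMap σ _) ≤ Submodule.span Fqm
        (Set.range fun i : Fin (k + 1) => (coordMap σ _)^[i] α) := by
      replace hα : C = Submodule.span Fqm
          (Set.range fun i : Fin k => (coordMap σ _)^[i] α) := by simpa only [hiter] using hα
      refine sup_le ?_ ?_
      · rw [hα, Submodule.span_le]
        rintro _ ⟨i, rfl⟩
        exact Submodule.subset_span ⟨i.castSucc, rfl⟩
      · rw [hα, Submodule.map_span, Submodule.span_le]
        rintro _ ⟨_, ⟨i, rfl⟩, rfl⟩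
        exact Submodule.subset_span ⟨i.succ, by simp [Function.iterate_succ_apply']⟩
    have h1 := Submodule.finrank_mono hle
    have h2 := finrank_range_le_card (R := Fqm) fun i : Fin (k + 1) => (coordMap σ _)^[i] α
    rw [Set.finrank, Fintype.card_fin] at h2
    omega
  · intro h1
    obtain ⟨l, rfl⟩ : ∃ l, k = l + 1 := ⟨k - 1, by omega⟩
    have hinj := coordMap_injective (ι := Fin n) σ
    have h2 := Submodule.finrank_sup_add_finrank_inf_eq C (C.map (coordMap σ _))
    have h3 := finrank_map_semilinear _ hinj C
    have h4 := finrank_inf_comap_semilinear _ hinj C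
    obtain ⟨v, hv⟩ := exists_span_iterate_eq _ hinj l C hdim hstable (by omega)
    refine ⟨v, ?_, by simpa only [hiter] using hv⟩
    rw [Fintype.linearIndependent_iff]
    intro c hc
    have hrel : C ≤ LinearMap.ker (∑ j, c j • LinearMap.proj (R := Fqm) (φ := fun _ => Fqm) j) := by
      rw [hv, Submodule.span_le]
      rintro _ ⟨i, rfl⟩
      have hpow (x : Fqm) : (φ ^ (i : ℕ)) x = x ^ q ^ (s * i) := by
        rw [AlgHom.coe_pow, show ⇑φ = (· ^ q ^ s) from funext hφ, pow_iterate, ← pow_mul]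
      have hzero := congrArg (φ ^ (i : ℕ)) hc
      simp only [map_sum, map_zero, map_smul] at hzero
      simpa only [SetLike.mem_coe, LinearMap.mem_ker, LinearMap.sum_apply, LinearMap.smul_apply,
        LinearMap.proj_apply, hiter, hpow] using hzero
    have h6 := hG.eq_zero_of_relation hkn.le 0 (hweight _ (hrow 0) hrow0) c fun r => by
      simpa using hrel (hrow r)
    simp [h6]
end
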